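/- arXiv:math/0703893 — 2 statements merged into one kernel-verified Lean document; each statement's English description precedes it below -/
import Mathlib

section
/- Let a_1,…,a_n be nonnegative integers, f(u) = ∏_{s=1}^n (u − z_s)/(u − z_s − a_s), and C(u) = ∏_{s=1}^n Γ(u − z_s + 1)/Γ(u − z_s − a_s + 1) (a polynomial in u satisfying C(u) = f(u)·C(u−1)). Let D'(u,τ) be the universal difference operator built exactly as D_{Q,M}(u,τ) but with each T_{ab}(u) replaced by f(u)·T_{ab}(u) (this is the universal difference operator associated with Q and the twisted module M_{Λ^{(1)}(a_1)}(z_1 + a_1) ⊗ … ⊗ M_{Λ^{(n)}(a_n)}(z_n + a_n), where Λ(a) = (Λ_1 + a,…,Λ_N + a)). Then a meromorphic M-valued function g(u) satisfies D_{Q,M}(u,τ) g = 0 if and only if the function C(u)g(u) satisfies D'(u,τ)(C·g) = 0. -/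
noncomputable section

namespace XXXModel

/-- A vector-valued quasi-exponential: a finite sum of functions
`Q₀^u p(u) = e^{(ln Q₀) u} p(u)` with `Q₀` a nonzero complex number with a fixed choice of
logarithm and `p` a vector-valued polynomial. -/
def IsQE {M : Type*} [AddCommGroup M] [Module ℂ M] (f : ℂ → M) : Prop :=
  ∃ (k d : ℕ) (lam : Fin k → ℂ) (v : Fin k → Fin d → M),
    ∀ u : ℂ, f u = ∑ i : Fin k, ∑ j : Fin d,
      (Complex.exp (lam i * u) * u ^ (j : ℕ)) • v i j

/-- `g` is meromorphic at the point `x`. -/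
def MeromAt (g : ℂ → ℂ) (x : ℂ) : Prop :=
  ∃ k : ℕ, AnalyticAt ℂ (fun z => (z - x) ^ k * g z) x

/-- Linear independence of a family of functions over the field of one-periodic
meromorphic functions on `ℂ`. -/
def IndepPeriodic {M : Type*} [AddCommGroup M] [Module ℂ M] {ι : Type*} [Fintype ι]
    (F : ι → ℂ → M) : Prop :=
  ∀ c : ι → ℂ → ℂ,
    (∀ i x, MeromAt (c i) x) →
    (∀ i x, c i (x + 1) = c i x) →
    (∀ x : ℂ, (∀ i, AnalyticAt ℂ (c i) x) → ∑ i, c i x • F i x = 0) →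
    ∀ i x, AnalyticAt ℂ (c i) x → c i x = 0

variable {N n : ℕ}

/-- Points where the universal difference operator (of order `N`) associated with the
evaluation points `z` is regular. -/
def Good (N : ℕ) {n : ℕ} (z : Fin n → ℂ) (u : ℂ) : Prop :=
  ∀ j : Fin n, ∀ k : ℕ, k < N → u - (k : ℂ) ≠ z j

section Setup

variable (V : Fin n → Type*) [∀ i, AddCommGroup (V i)] [∀ i, Module ℂ (V i)]
  (M : Type*) [AddCommGroup M] [Module ℂ M]
  (E : ∀ i : Fin n, Fin N → Fin N → (V i →ₗ[ℂ] V i))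
  (φ : M ≃ₗ[ℂ] PiTensorProduct ℂ V)

/-- The commutation relations of `gl_N`: `[e_{ab}, e_{cd}] = δ_{bc} e_{ad} − δ_{da} e_{cb}`,
for the operators `E i a b` (the action of `e_{ab}` on the `i`-th factor `V i`). -/
def GlRel : Prop :=
  ∀ (i : Fin n) (a b c d : Fin N),
    E i a b ∘ₗ E i c d - E i c d ∘ₗ E i a b =
      (if b = c then (1 : ℂ) else 0) • E i a d - (if d = a then (1 : ℂ) else 0) • E i c b

/-- Each `V i` is the irreducible finite-dimensional `gl_N`-module with highest weight
`Λ i`: it is generated by a nonzero vector `v` with `e_{ab} v = 0` for `a < b` and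
`e_{aa} v = Λ_a v`. -/
def IsHW (Λ : Fin n → Fin N → ℤ) : Prop :=
  ∀ i : Fin n, ∃ v : V i, v ≠ 0 ∧
    (∀ a b : Fin N, a < b → E i a b v = 0) ∧
    (∀ a : Fin N, E i a a v = (Λ i a : ℂ) • v) ∧
    ∀ W : Submodule ℂ (V i), (∀ a b : Fin N, ∀ x ∈ W, E i a b x ∈ W) → v ∈ W →
      ∀ x : V i, x ∈ W

/-- `e_{ab}` acting in the `j`-th tensor factor of `M ≃ V 1 ⊗ ⋯ ⊗ V n`. -/
def EE (j : Fin n) (a b : Fin N) : Module.End ℂ M :=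
  φ.symm.toLinearMap ∘ₗ
    (PiTensorProduct.map
      (Function.update (fun i : Fin n => (LinearMap.id : V i →ₗ[ℂ] V i)) j (E j a b))) ∘ₗ
    φ.toLinearMap

variable (z : Fin n → ℂ)

/-- The matrix `L^{(j)}(u - z_j)`, with entries `L_{ab} = δ_{ab} + e_{ba}^{(j)}/(u - z_j)`. -/
def Lmat (j : Fin n) (u : ℂ) : Matrix (Fin N) (Fin N) (Module.End ℂ M) :=
  fun a b => (if a = b then 1 else 0) + (u - z j)⁻¹ • EE V M E φ j b a

/-- The Yangian generating series acting on the tensor product of evaluation modules: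
`T(u) = L^{(n)}(u−z_n) ⋯ L^{(1)}(u−z_1)`. -/
def Tmat (u : ℂ) : Matrix (Fin N) (Fin N) (Module.End ℂ M) :=
  ((List.ofFn fun j : Fin n => Lmat V M E φ z j u).reverse).prod

variable (Q : Matrix (Fin N) (Fin N) ℂ)

/-- `X_{ab}(u,τ) = δ_{ab} − ∑_c Q_{ac} T_{cb}(u) τ^{−1}`, acting on `M`-valued functions. -/
def Xop (a b : Fin N) (f : ℂ → M) : ℂ → M :=
  fun u => (if a = b then f u else 0)
    - ∑ c : Fin N, Q a c • (Tmat V M E φ z u c b) (f (u - 1))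

/-- The universal difference operator
`D_{Q,M}(u,τ) = ∑_{σ ∈ S_N} sgn(σ) X_{1σ(1)}(u,τ) ⋯ X_{Nσ(N)}(u,τ)`. -/
def Dop (f : ℂ → M) : ℂ → M :=
  fun u => ∑ σ : Equiv.Perm (Fin N),
    ((Equiv.Perm.sign σ : ℤˣ) : ℤ) •
      (((List.ofFn fun a : Fin N => Xop V M E φ z Q a (σ a)).foldr (· ∘ ·) id) f u)

/-- The weight subspace `M[m]`. -/
def Wt (m : Fin N → ℤ) : Submodule ℂ M :=
  ⨅ a : Fin N, LinearMap.ker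
    ((∑ j : Fin n, EE V M E φ j a a) - (m a : ℂ) • (1 : Module.End ℂ M))

/-- The subspace `sing M[m]` of `gl_N`-singular vectors of weight `m`. -/
def SingWt (m : Fin N → ℤ) : Submodule ℂ M :=
  Wt V M E φ m ⊓ ⨅ a : Fin N, ⨅ b : Fin N, ⨅ _ : a < b,
    LinearMap.ker (∑ j : Fin n, EE V M E φ j a b)

end Setup

end XXXModel

namespace XXXModel

section Twist

variable {N n : ℕ}
variable (V : Fin n → Type*) [∀ i, AddCommGroup (V i)] [∀ i, Module ℂ (V i)]
  (M : Type*) [AddCommGroup M] [Module ℂ M]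
  (E : ∀ i : Fin n, Fin N → Fin N → (V i →ₗ[ℂ] V i))
  (φ : M ≃ₗ[ℂ] PiTensorProduct ℂ V)
  (z : Fin n → ℂ) (a : Fin n → ℕ) (Q : Matrix (Fin N) (Fin N) ℂ)

/-- The operator `X_{ij}(u,τ)` with each `T_{cb}(u)` replaced by `f(u)·T_{cb}(u)`, where
`f(u) = ∏_s (u − z_s)/(u − z_s − a_s)`.  This is the building block of the universal
difference operator associated with `Q` and the twisted module
`M_{Λ^{(1)}(a_1)}(z_1+a_1) ⊗ ⋯ ⊗ M_{Λ^{(n)}(a_n)}(z_n+a_n)`. -/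
def XopTw (i j : Fin N) (f : ℂ → M) : ℂ → M :=
  fun u => (if i = j then f u else 0)
    - ∑ c : Fin N, Q i c •
        ((∏ s : Fin n, (u - z s) / (u - z s - (a s : ℂ))) •
          (Tmat V M E φ z u c j) (f (u - 1)))

/-- The universal difference operator with `T(u)` replaced by `f(u)·T(u)`. -/
def DopTw (f : ℂ → M) : ℂ → M :=
  fun u => ∑ σ : Equiv.Perm (Fin N),
    ((Equiv.Perm.sign σ : ℤˣ) : ℤ) •
      (((List.ofFn fun i : Fin N => XopTw V M E φ z a Q i (σ i)).foldr (· ∘ ·) id) f u)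

/-- Points where both universal difference operators and the multiplier `C` are regular
and `C` is nonvanishing. -/
def GoodTw (N : ℕ) (u : ℂ) : Prop :=
  ∀ s : Fin n, ∀ k : ℕ, k ≤ N → ∀ j : ℕ, j ≤ a s → u - (k : ℂ) ≠ z s + (j : ℂ)

end Twist

section TwistProof

variable {N n : ℕ}

theorem mult_rec (z : Fin n → ℂ) (a : Fin n → ℕ) (C : ℂ → ℂ)
    (hC : ∀ u : ℂ, C u = ∏ s : Fin n, ∏ k ∈ Finset.range (a s), (u - z s - (k : ℕ)))
    (v : ℂ) (hv : ∀ s, v ≠ z s + (a s : ℂ)) :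
    (∏ s : Fin n, (v - z s) / (v - z s - (a s : ℂ))) * C (v - 1) = C v := by
  rw [hC, hC, ← Finset.prod_mul_distrib]
  refine Finset.prod_congr rfl fun s _ => ?_
  have h0 : v - z s - (a s : ℂ) ≠ 0 := by
    intro h
    exact hv s (by linear_combination h)
  have h1 := Finset.prod_range_succ (fun k : ℕ => v - z s - (k : ℂ)) (a s)
  have h2 := Finset.prod_range_succ' (fun k : ℕ => v - z s - (k : ℂ)) (a s)
  have h3 : ∏ k ∈ Finset.range (a s), (v - 1 - z s - (k : ℂ)) =
      ∏ k ∈ Finset.range (a s), (v - z s - ((k + 1 : ℕ) : ℂ)) := by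
    refine Finset.prod_congr rfl fun k _ => ?_
    push_cast
    ring
  rw [h3, div_mul_eq_mul_div, div_eq_iff h0, ← h1, h2]
  push_cast
  ring

variable (V : Fin n → Type*) [∀ i, AddCommGroup (V i)] [∀ i, Module ℂ (V i)]
  (M : Type*) [AddCommGroup M] [Module ℂ M]
  (E : ∀ i : Fin n, Fin N → Fin N → (V i →ₗ[ℂ] V i))
  (φ : M ≃ₗ[ℂ] PiTensorProduct ℂ V)
  (z : Fin n → ℂ) (a : Fin n → ℕ) (Q : Matrix (Fin N) (Fin N) ℂ)

theorem fold_twist (C : ℂ → ℂ) (g : ℂ → M) (σ : Fin N → Fin N) (l : List (Fin N)) :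
    ∀ v : ℂ, (∀ k : ℕ, k < l.length →
      (∏ s : Fin n, ((v - k) - z s) / ((v - k) - z s - (a s : ℂ))) * C (v - k - 1) = C (v - k)) →
    ((l.map fun i => XopTw V M E φ z a Q i (σ i)).foldr (· ∘ ·) id) (fun x => C x • g x) v =
      C v • ((l.map fun i => Xop V M E φ z Q i (σ i)).foldr (· ∘ ·) id) g v := by
  induction l with
  | nil => intro v _; simp
  | cons i l ih =>
    intro v hv
    have e0 := ih v (fun k hk => hv k (by simp; omega))
    have e1 := ih (v - 1) (fun k hk => by
      have := hv (k + 1) (by simpa using hk)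
      have e : v - ((k + 1 : ℕ) : ℂ) = v - 1 - k := by push_cast; ring
      rw [e] at this
      exact this)
    have r := hv 0 (by simp)
    simp only [Nat.cast_zero, sub_zero] at r
    simp only [List.map_cons, List.foldr_cons, Function.comp_apply]
    rw [XopTw, Xop, e0, e1, smul_sub, Finset.smul_sum]
    congr 1
    · split_ifs <;> simp
    · refine Finset.sum_congr rfl fun c _ => ?_
      rw [map_smul, smul_smul _ (C (v - 1)), r, smul_comm]

theorem Dop_twist (C : ℂ → ℂ)
    (hC : ∀ u : ℂ, C u = ∏ s : Fin n, ∏ k ∈ Finset.range (a s), (u - z s - (k : ℕ)))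
    (g : ℂ → M) (u : ℂ) (hu : GoodTw z a N u) :
    DopTw V M E φ z a Q (fun x => C x • g x) u = C u • Dop V M E φ z Q g u := by
  rw [DopTw, Dop, Finset.smul_sum]
  refine Finset.sum_congr rfl fun σ _ => ?_
  rw [List.ofFn_eq_map, List.ofFn_eq_map, fold_twist, smul_comm]
  intro k hk
  rw [List.length_finRange] at hk
  exact mult_rec z a C hC _ fun s => hu s k hk.le _ le_rfl

end TwistProof

/-- comparison theorem for the XXX model.  Let `a_1, …, a_n` be
nonnegative integers and `C(u) = ∏_s Γ(u − z_s + 1)/Γ(u − z_s − a_s + 1)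
= ∏_s (u − z_s)(u − z_s − 1) ⋯ (u − z_s − a_s + 1)`.  A function `g` satisfies
`D_{Q,M}(u,τ) g = 0` if and only if `C·g` satisfies `D'(u,τ)(C·g) = 0`, where `D'` is the
universal difference operator with each `T_{ab}(u)` replaced by
`∏_s ((u − z_s)/(u − z_s − a_s)) · T_{ab}(u)`. -/
theorem statement_7
    {N n : ℕ} (hN : 2 ≤ N) (hn : 1 ≤ n)
    (V : Fin n → Type*) [∀ i, AddCommGroup (V i)] [∀ i, Module ℂ (V i)]
    [∀ i, FiniteDimensional ℂ (V i)]
    (M : Type*) [AddCommGroup M] [Module ℂ M] [FiniteDimensional ℂ M]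
    (Λ : Fin n → Fin N → ℤ)
    (hdom : ∀ i, ∀ a b : Fin N, a ≤ b → Λ i b ≤ Λ i a)
    (hpoly : ∀ i a, 0 ≤ Λ i a)
    (E : ∀ i : Fin n, Fin N → Fin N → (V i →ₗ[ℂ] V i))
    (hrel : GlRel V E)
    (hhw : IsHW V E Λ)
    (φ : M ≃ₗ[ℂ] PiTensorProduct ℂ V)
    (z : Fin n → ℂ)
    (Q : Matrix (Fin N) (Fin N) ℂ) (hQ : IsUnit Q.det)
    (a : Fin n → ℕ)
    (C : ℂ → ℂ)
    (hC : ∀ u : ℂ, C u = ∏ s : Fin n, ∏ k ∈ Finset.range (a s), (u - z s - (k : ℕ)))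
    (g : ℂ → M) :
    (∀ u : ℂ, GoodTw z a N u → Dop V M E φ z Q g u = 0) ↔
    (∀ u : ℂ, GoodTw z a N u → DopTw V M E φ z a Q (fun x => C x • g x) u = 0) := by
  have hC0 : ∀ u : ℂ, GoodTw z a N u → C u ≠ 0 := by
    intro u hu
    rw [hC]
    refine Finset.prod_ne_zero_iff.2 fun s _ => Finset.prod_ne_zero_iff.2 fun k hk => ?_
    intro h
    refine hu s 0 (Nat.zero_le _) k (Finset.mem_range.1 hk).le ?_
    push_cast
    linear_combination h
  refine forall_congr' fun u => forall_congr' fun hu => ?_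
  rw [Dop_twist V M E φ z a Q C hC g u hu, smul_eq_zero_iff_right (hC0 u hu)]

end XXXModel
end
end

section
/- Assume the diagonal entries Q_1,…,Q_N of Q are nonzero and pairwise distinct, with a fixed choice of argument of each. Then for every i ∈ {1,…,N} and every nonzero v_0 ∈ M[m] there exist vectors v_1,…,v_{m_i} ∈ M[m] such that the quasi-exponential Q_i^u (v_0 u^{m_i} + v_1 u^{m_i−1} + … + v_{m_i}) lies in the kernel of D_{Q,M}(u,τ) restricted to M[m]-valued functions. Moreover, quasi-exponentials of this form generate the kernel: there exist N·dim(M[m]) such quasi-exponentials lying in the kernel which are linearly independent over the field of one-periodic meromorphic functions on ℂ. -/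
noncomputable section

namespace XXXModel

/-- Raise the index `c` of a multi-index unless `c = a`. -/
def up {N : ℕ} (a : Fin N) (α : Fin N → ℕ) (c : Fin N) : Fin N → ℕ :=
  fun k => if k = c ∧ c ≠ a then α k + 1 else α k

/-- Lower the index `k` of a multi-index. -/
def dn {N : ℕ} (α : Fin N → ℕ) (k : Fin N) : Fin N → ℕ :=
  fun l => if l = k then α l - 1 else α l

/-- The first order difference system for a family of functions. -/
def Sys {N : ℕ} {M : Type*} [AddCommGroup M] [Module ℂ M] (a : Fin N) (ρ : Fin N → ℂ)
    (R : ℂ → Prop) (T : ℂ → Fin N → Fin N → Module.End ℂ M)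
    (φ : (Fin N → ℕ) → ℂ → M) : Prop :=
  ∀ α b u, R u → φ (up a α b) u = ∑ c, ρ c • T u c b (φ (up a α c) (u - 1))

lemma combine {N : ℕ} {M X : Type*} [AddCommGroup M] [Module ℂ M] [AddCommGroup X] [Module ℂ X]
    (a : Fin N) (ρ : Fin N → ℂ) (R : ℂ → Prop)
    (x : Fin N → X →ₗ[ℂ] M) (TX T2 : ℂ → Fin N → Fin N → Module.End ℂ X)
    (TM : ℂ → Fin N → Fin N → Module.End ℂ M) (Θ : Module.End ℂ X) (z : ℂ)
    (hTM : ∀ u, R u → ∀ c b k g, TM u c b (x k g) = x k (TX u c b g) +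
      if c = k then (u - z)⁻¹ • ∑ d, x d (T2 u d b g) else 0)
    (hT2 : ∀ u, R u → ∀ b g, (u - z)⁻¹ • ∑ d, x d (T2 u d b ((u - z) • g + Θ g)) =
      ∑ d, x d (TX u d b g))
    (ψ : (Fin N → ℕ) → Fin N → ℂ → X) (σ : (Fin N → ℕ) → ℂ → X)
    (p1 : ∀ α b k u, R u → ψ (up a α b) k u =
      ∑ c, ρ c • TX u c b (ψ (up a α c) k (u - 1)) + TX u k b (σ α (u - 1)))
    (p2 : ∀ α v, ∑ c, ρ c • ψ (up a α c) c v = (v + 1 - z) • σ α v + Θ (σ α v)) :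
    Sys a ρ R TM (fun α u => ∑ k, x k (ψ α k u)) := by
  intro α b u hu
  have h1 : ∀ c, TM u c b (∑ k, x k (ψ (up a α c) k (u - 1))) =
      ∑ k, x k (TX u c b (ψ (up a α c) k (u - 1))) +
        (u - z)⁻¹ • ∑ d, x d (T2 u d b (ψ (up a α c) c (u - 1))) := by
    intro c
    rw [map_sum]
    simp only [hTM u hu, Finset.sum_add_distrib, Finset.sum_ite_eq, Finset.mem_univ, if_true]
  simp only [h1, smul_add, Finset.sum_add_distrib]
  have h2 : ∑ c, ρ c • (u - z)⁻¹ • ∑ d, x d (T2 u d b (ψ (up a α c) c (u - 1))) =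
      ∑ d, x d (TX u d b (σ α (u - 1))) := by
    rw [← hT2 u hu]
    have : (u - z) • σ α (u - 1) + Θ (σ α (u - 1)) = ∑ c, ρ c • ψ (up a α c) c (u - 1) := by
      rw [p2]; congr 2; ring
    rw [this]
    simp only [map_sum, map_smul, Finset.smul_sum]
    rw [Finset.sum_comm]
    refine Finset.sum_congr rfl fun d _ => Finset.sum_congr rfl fun c _ => ?_
    rw [smul_comm]
  rw [h2]
  simp only [p1 α b _ u hu, map_add, map_sum, map_smul, Finset.sum_add_distrib, Finset.smul_sum]
  rw [Finset.sum_comm]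

lemma up_self {N : ℕ} (a : Fin N) (α : Fin N → ℕ) : up a α a = α := by
  funext k; simp [up]

lemma up_apply {N : ℕ} {a : Fin N} (α : Fin N → ℕ) (c k : Fin N) (hk : k ≠ a) :
    up a α c k = α k + if k = c then 1 else 0 := by
  unfold up
  by_cases h : k = c
  · subst h; simp [hk]
  · simp [h]

lemma up_comm {N : ℕ} (a : Fin N) (α : Fin N → ℕ) (c d : Fin N) :
    up a (up a α c) d = up a (up a α d) c := by
  funext k
  unfold up
  split_ifs <;> simp_all

lemma up_dn {N : ℕ} {X : Type*} [AddCommGroup X] [Module ℂ X] {a : Fin N}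
    (α : Fin N → ℕ) (b k : Fin N) (hk : k ≠ a)
    (f : (Fin N → ℕ) → X) :
    ((up a α b k : ℕ) : ℂ) • f (dn (up a α b) k) =
      (α k : ℂ) • f (up a (dn α k) b) + if k = b then f α else 0 := by
  rw [up_apply α b k hk]
  by_cases h : k = b
  · subst h
    have h1 : dn (up a α k) k = α := by
      funext l; unfold dn up; by_cases hl : l = k <;> simp [hl, hk]
    simp only [if_true, h1]
    by_cases h0 : α k = 0
    · simp [h0]
    · have h2 : up a (dn α k) k = α := by
        funext l; unfold dn up
        by_cases hl : l = k
        · subst hl; simp [hk]; omega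
        · simp [hl]
      rw [h2]; push_cast; rw [add_smul, one_smul]
  · have h1 : dn (up a α b) k = up a (dn α k) b := by
      funext l; unfold dn up
      by_cases hl : l = k
      · subst hl; simp [h]
      · simp [hl]
    simp [h, h1]

/-- The new family of functions obtained from a solution for the smaller module. -/
def psi {N : ℕ} {X : Type*} [AddCommGroup X] [Module ℂ X] (a : Fin N) (ρ β : Fin N → ℂ)
    (G : Fin N → Module.End ℂ X) (Θ : Module.End ℂ X) (z : ℂ)
    (φ : (Fin N → ℕ) → ℂ → X) (α : Fin N → ℕ) (k : Fin N) (u : ℂ) : X :=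
  (if k = a then (u + 1 - z + ∑ l, β l * ρ l + ∑ l, β l * ρ l * α l) • φ α u + Θ (φ α u)
      - ∑ l, (β l * ρ l) • G l (φ (up a α l) u) else 0)
    + β k • (G k (φ α u) - (α k : ℂ) • φ (dn α k) u)

lemma psi_of_ne {N : ℕ} {X : Type*} [AddCommGroup X] [Module ℂ X] {a : Fin N} (ρ β : Fin N → ℂ)
    (G : Fin N → Module.End ℂ X) (Θ : Module.End ℂ X) (z : ℂ)
    (φ : (Fin N → ℕ) → ℂ → X) (α : Fin N → ℕ) (k : Fin N) (u : ℂ) (hk : k ≠ a) :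
    psi a ρ β G Θ z φ α k u = β k • (G k (φ α u) - (α k : ℂ) • φ (dn α k) u) := by
  simp [psi, hk]

lemma psi_self {N : ℕ} {X : Type*} [AddCommGroup X] [Module ℂ X] {a : Fin N} (ρ β : Fin N → ℂ)
    (hβa : β a = 0)
    (G : Fin N → Module.End ℂ X) (Θ : Module.End ℂ X) (z : ℂ)
    (φ : (Fin N → ℕ) → ℂ → X) (α : Fin N → ℕ) (u : ℂ) :
    psi a ρ β G Θ z φ α a u =
      (u + 1 - z + ∑ l, β l * ρ l + ∑ l, β l * ρ l * α l) • φ α u + Θ (φ α u)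
      - ∑ l, (β l * ρ l) • G l (φ (up a α l) u) := by
  simp [psi, hβa]

lemma psi_trace {N : ℕ} {X : Type*} [AddCommGroup X] [Module ℂ X] (a : Fin N)
    (ρ β : Fin N → ℂ) (hρ : ρ a = 1) (hβa : β a = 0)
    (G : Fin N → Module.End ℂ X) (Θ : Module.End ℂ X) (z : ℂ)
    (φ : (Fin N → ℕ) → ℂ → X) (α : Fin N → ℕ) (v : ℂ) :
    ∑ c, ρ c • psi a ρ β G Θ z φ (up a α c) c v = (v + 1 - z) • φ α v + Θ (φ α v) := by
  have h : ∀ c, ρ c • psi a ρ β G Θ z φ (up a α c) c v =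
      (if c = a then (v + 1 - z + ∑ l, β l * ρ l + ∑ l, β l * ρ l * α l) • φ α v + Θ (φ α v)
      - ∑ l, (β l * ρ l) • G l (φ (up a α l) v) else 0)
      + ((β c * ρ c) • G c (φ (up a α c) v) - (β c * ρ c * α c + β c * ρ c) • φ α v) := by
    intro c
    by_cases hc : c = a
    · subst hc
      rw [psi_self _ _ hβa, up_self]; simp [hρ, hβa]
    · rw [psi_of_ne _ _ _ _ _ _ _ _ _ hc]
      have := up_dn (a := a) α c c hc (fun α => φ α v)
      simp only [if_true] at this
      have h2 : (α c : ℂ) • φ (up a (dn α c) c) v = (α c : ℂ) • φ α v := by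
        by_cases h0 : α c = 0
        · simp [h0]
        · congr 2
          funext l; unfold dn up
          by_cases hl : l = c
          · subst hl; simp [hc]; omega
          · simp [hl]
      rw [h2] at this
      rw [this]
      simp only [hc, if_false, zero_add, smul_sub, smul_add, smul_smul]
      module
  simp only [h, Finset.sum_add_distrib, Finset.sum_sub_distrib, Finset.sum_ite_eq',
    Finset.mem_univ, if_true, ← Finset.sum_smul]
  module

lemma psi_p1 {N : ℕ} {X : Type*} [AddCommGroup X] [Module ℂ X] (a : Fin N)
    (ρ β : Fin N → ℂ) (hρ : ρ a = 1) (hβa : β a = 0)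
    (hβ : ∀ k, k ≠ a → β k * (ρ k - 1) = 1) (R : ℂ → Prop)
    (TX : ℂ → Fin N → Fin N → Module.End ℂ X)
    (G : Fin N → Module.End ℂ X) (Θ : Module.End ℂ X) (z : ℂ)
    (hG : ∀ u, R u → ∀ c b k g, TX u c b (G k g) = G k (TX u c b g)
      - (if k = b then TX u c a g else 0) + (if c = a then TX u k b g else 0))
    (hΘ : ∀ u, R u → ∀ c b g, TX u c b (Θ g) = Θ (TX u c b g))
    (φ : (Fin N → ℕ) → ℂ → X) (hφ : Sys a ρ R TX φ) (α : Fin N → ℕ) (b k : Fin N) (u : ℂ)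
    (hu : R u) :
    psi a ρ β G Θ z φ (up a α b) k u =
      ∑ c, ρ c • TX u c b (psi a ρ β G Θ z φ (up a α c) k (u - 1))
        + TX u k b (φ α (u - 1)) := by
  have hsum : ∀ α b, ∑ c, ρ c • TX u c b (φ (up a α c) (u - 1)) = φ (up a α b) u :=
    fun α b => (hφ α b u hu).symm
  have hGs : ∀ α k, ∑ c, ρ c • TX u c b (G k (φ (up a α c) (u - 1))) =
      G k (φ (up a α b) u) - (if k = b then φ α u else 0) + TX u k b (φ α (u - 1)) := by
    intro α k
    simp only [hG u hu, smul_add, smul_sub, Finset.sum_add_distrib, Finset.sum_sub_distrib]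
    congr 1
    · congr 1
      · rw [← hsum α b, map_sum]; simp
      · by_cases h : k = b
        · simp only [h, if_true]; rw [hsum, up_self]
        · simp [h]
    · simp [hρ, up_self]
  by_cases hk : k = a
  · subst hk
    simp only [psi_self _ _ hβa]
    set B := ∑ l, β l * ρ l with hB
    have e1 : ∀ c, ρ c • TX u c b (((u - 1) + 1 - z + B + ∑ l, β l * ρ l * (up k α c l : ℕ)) •
          φ (up k α c) (u - 1) + Θ (φ (up k α c) (u - 1))
          - ∑ l, (β l * ρ l) • G l (φ (up k (up k α c) l) (u - 1))) =
        ((u - z + B + ∑ l, β l * ρ l * α l) • (ρ c • TX u c b (φ (up k α c) (u - 1)))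
        + Θ (ρ c • TX u c b (φ (up k α c) (u - 1)))
        - ∑ l, (β l * ρ l) • (ρ c • TX u c b (G l (φ (up k (up k α l) c) (u - 1)))))
        + (β c * ρ c) • (ρ c • TX u c b (φ (up k α c) (u - 1))) := by
      intro c
      have e2 : ∑ l, β l * ρ l * (up k α c l : ℕ) = ∑ l, β l * ρ l * α l + β c * ρ c := by
        have : ∀ l, β l * ρ l * ((up k α c l : ℕ) : ℂ) = β l * ρ l * α l +
            if l = c then β c * ρ c else 0 := by
          intro l
          by_cases hl : l = k
          · subst hl
            by_cases h : l = c
            · subst h; simp [hβa]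
            · simp [hβa, h]
          · rw [up_apply α c l hl]
            by_cases h : l = c
            · subst h; simp; ring
            · simp [h]
        simp [this, Finset.sum_add_distrib]
      rw [e2]
      simp only [map_add, map_sub, map_smul, map_sum, hΘ u hu, up_comm k α c, smul_add, smul_sub,
        Finset.smul_sum]
      simp only [smul_comm (ρ c) (β _ * ρ _)]
      module
    simp only [e1, Finset.sum_add_distrib, Finset.sum_sub_distrib, ← Finset.smul_sum, ← map_sum,
      hsum]
    rw [Finset.sum_comm]
    simp only [← Finset.smul_sum, hGs]
    have e3 : ∑ l, β l * ρ l * ((up k α b l : ℕ) : ℂ) =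
        ∑ l, β l * ρ l * α l + β b * ρ b := by
      have : ∀ l, β l * ρ l * ((up k α b l : ℕ) : ℂ) = β l * ρ l * α l +
          if l = b then β b * ρ b else 0 := by
        intro l
        by_cases hl : l = k
        · subst hl
          by_cases h : l = b
          · subst h; simp [hβa]
          · simp [hβa, h]
        · rw [up_apply α b l hl]
          by_cases h : l = b
          · subst h; simp; ring
          · simp [h]
      simp [this, Finset.sum_add_distrib]
    rw [e3]
    have e4 : ∑ l, (β l * ρ l) • (G l (φ (up k (up k α l) b) u)
          - (if l = b then φ (up k α l) u else 0) + TX u l b (φ (up k α l) (u - 1))) =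
        ∑ l, (β l * ρ l) • G l (φ (up k (up k α b) l) u) - (β b * ρ b) • φ (up k α b) u
        + ∑ l, (β l * ρ l) • TX u l b (φ (up k α l) (u - 1)) := by
      simp only [smul_add, smul_sub, Finset.sum_add_distrib, Finset.sum_sub_distrib, smul_ite,
        smul_zero, Finset.sum_ite_eq', Finset.mem_univ, if_true, up_comm k α b]
    rw [e4]
    have e5 : ∑ c, (β c * ρ c) • (ρ c • TX u c b (φ (up k α c) (u - 1)))
        = ∑ l, (β l * ρ l) • TX u l b (φ (up k α l) (u - 1)) + φ (up k α b) u
          - TX u k b (φ α (u - 1)) := by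
      rw [← hsum α b]
      have : ∀ c, (β c * ρ c) • (ρ c • TX u c b (φ (up k α c) (u - 1))) =
          (β c * ρ c) • TX u c b (φ (up k α c) (u - 1)) +
          ρ c • TX u c b (φ (up k α c) (u - 1)) -
          if c = k then TX u k b (φ α (u - 1)) else 0 := by
        intro c
        by_cases h : c = k
        · subst h; simp [hβa, hρ, up_self]
        · have := hβ c h
          simp only [h, if_false, sub_zero, smul_smul, ← add_smul]
          congr 1
          linear_combination (ρ c) * this
      simp only [this, Finset.sum_add_distrib, Finset.sum_sub_distrib, Finset.sum_ite_eq',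
        Finset.mem_univ, if_true]
    rw [e5]
    module
  · simp only [psi_of_ne _ _ _ _ _ _ _ _ _ hk]
    have h1 := fun c v => up_dn (a := a) α c k hk (fun α => φ α v)
    simp only [h1, map_smul, map_sub, map_add, smul_sub, smul_add, Finset.sum_sub_distrib,
      Finset.sum_add_distrib]
    have e1 : ∑ c, ρ c • β k • TX u c b (G k (φ (up a α c) (u - 1))) =
        β k • (G k (φ (up a α b) u) - (if k = b then φ α u else 0)
          + TX u k b (φ α (u - 1))) := by
      rw [← hGs, Finset.smul_sum]
      exact Finset.sum_congr rfl fun c _ => smul_comm _ _ _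
    have e2 : ∑ c, ρ c • β k • (α k : ℂ) • TX u c b (φ (up a (dn α k) c) (u - 1)) =
        β k • (α k : ℂ) • φ (up a (dn α k) b) u := by
      rw [← hsum, Finset.smul_sum, Finset.smul_sum]
      exact Finset.sum_congr rfl fun c _ => by module
    have e3 : ∑ c, ρ c • β k • TX u c b (if k = c then φ α (u - 1) else 0) =
        (β k * ρ k) • TX u k b (φ α (u - 1)) := by
      have : ∀ c, ρ c • β k • TX u c b (if k = c then φ α (u - 1) else 0) =
          if k = c then (β k * ρ k) • TX u k b (φ α (u - 1)) else 0 := by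
        intro c; by_cases h : k = c
        · subst h; simp [smul_smul, mul_comm]
        · simp [h]
      simp [this]
    rw [e1, e2, e3]
    have h3 : β k * ρ k = β k + 1 := by linear_combination hβ k hk
    rw [h3]
    module

end XXXModel

namespace XXXModel

/-- The relations of `gl_N` for a family of endomorphisms. -/
def Gl {N : ℕ} {M : Type*} [AddCommGroup M] [Module ℂ M]
    (e : Fin N → Fin N → Module.End ℂ M) : Prop :=
  ∀ a b c d, ∀ v, e a b (e c d v) - e c d (e a b v) =
    (if b = c then e a d v else 0) - (if d = a then e c b v else 0)

/-- Polynomial with roots `0, …, K-1`. -/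
def nnp (K : ℕ) : Polynomial ℂ := ∏ k ∈ Finset.range K, (Polynomial.X - Polynomial.C (k : ℂ))

/-- Chain conditions. -/
structure Chain {N n : ℕ} {M : Type*} [AddCommGroup M] [Module ℂ M]
    (e : Fin n → Fin N → Fin N → Module.End ℂ M) : Prop where
  gl : ∀ j, Gl (e j)
  comm : ∀ i j, i ≠ j → ∀ a b c d v, e i a b (e j c d v) = e j c d (e i a b v)
  nn : ∀ j a, ∃ K, Polynomial.aeval (e j a a) (nnp K) = 0

/-- The one-site matrix. -/
def LL {N : ℕ} {M : Type*} [AddCommGroup M] [Module ℂ M] (z : ℂ)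
    (e : Fin N → Fin N → Module.End ℂ M) (u : ℂ) : Matrix (Fin N) (Fin N) (Module.End ℂ M) :=
  fun a b => (if a = b then 1 else 0) + (u - z)⁻¹ • e b a

/-- The monodromy matrix. -/
def TC {N : ℕ} {M : Type*} [AddCommGroup M] [Module ℂ M] : {n : ℕ} → (Fin n → ℂ) →
    (Fin n → Fin N → Fin N → Module.End ℂ M) → ℂ → Matrix (Fin N) (Fin N) (Module.End ℂ M)
  | 0, _, _, _ => 1
  | n + 1, z, e, u => LL (z (Fin.last n)) (e (Fin.last n)) u *
      TC (fun j => z j.castSucc) (fun j => e j.castSucc) u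

lemma TC_succ_apply {N n : ℕ} {M : Type*} [AddCommGroup M] [Module ℂ M] (z : Fin (n + 1) → ℂ)
    (e : Fin (n + 1) → Fin N → Fin N → Module.End ℂ M) (u : ℂ) (a b : Fin N) (v : M) :
    TC z e u a b v = ∑ c, LL (z (Fin.last n)) (e (Fin.last n)) u a c
      (TC (fun j => z j.castSucc) (fun j => e j.castSucc) u c b v) := by
  simp [TC, Matrix.mul_apply]

lemma LL_apply {N : ℕ} {M : Type*} [AddCommGroup M] [Module ℂ M] (z : ℂ)
    (e : Fin N → Fin N → Module.End ℂ M) (u : ℂ) (a b : Fin N) (v : M) :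
    LL z e u a b v = (if a = b then v else 0) + (u - z)⁻¹ • e b a v := by
  unfold LL
  by_cases h : a = b <;> simp [h]

lemma TC_zero_apply {N : ℕ} {M : Type*} [AddCommGroup M] [Module ℂ M] (z : Fin 0 → ℂ)
    (e : Fin 0 → Fin N → Fin N → Module.End ℂ M) (u : ℂ) (a b : Fin N) (v : M) :
    TC z e u a b v = if a = b then v else 0 := by
  unfold TC
  rw [Matrix.one_apply]
  by_cases h : a = b <;> simp [h]

lemma TC_intertwine {N : ℕ} {M X : Type*} [AddCommGroup M] [Module ℂ M] [AddCommGroup X]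
    [Module ℂ X] (x : X →ₗ[ℂ] M) : ∀ {n : ℕ} (z : Fin n → ℂ)
    (eM : Fin n → Fin N → Fin N → Module.End ℂ M) (eX : Fin n → Fin N → Fin N → Module.End ℂ X)
    (_ : ∀ j a b g, eM j a b (x g) = x (eX j a b g)) (u : ℂ) (a b : Fin N) (g : X),
    TC z eM u a b (x g) = x (TC z eX u a b g)
  | 0, z, eM, eX, h, u, a, b, g => by
    rw [TC_zero_apply, TC_zero_apply]; split_ifs <;> simp
  | n + 1, z, eM, eX, h, u, a, b, g => by
    rw [TC_succ_apply, TC_succ_apply, map_sum]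
    refine Finset.sum_congr rfl fun c _ => ?_
    rw [TC_intertwine x (fun j => z j.castSucc) (fun j => eM j.castSucc)
      (fun j => eX j.castSucc) (fun j => h j.castSucc)]
    rw [LL_apply, LL_apply, map_add, map_smul, h]
    split_ifs <;> simp

lemma LL_equiv {N : ℕ} {M : Type*} [AddCommGroup M] [Module ℂ M] (z : ℂ)
    (e : Fin N → Fin N → Module.End ℂ M) (he : Gl e) (u : ℂ) (x y c b : Fin N) (v : M) :
    e x y (LL z e u c b v) = LL z e u c b (e x y v) + (if y = b then LL z e u c x v else 0)
      - (if x = c then LL z e u y b v else 0) := by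
  simp only [LL_apply, map_add, map_smul]
  have h := he x y b c v
  rw [sub_eq_iff_eq_add] at h
  rw [h]
  by_cases h1 : y = b <;> by_cases h2 : x = c <;> by_cases h3 : c = b <;>
    simp_all [eq_comm] <;> (try module)

lemma TC_equiv {N : ℕ} {M : Type*} [AddCommGroup M] [Module ℂ M] : ∀ {n : ℕ} (z : Fin n → ℂ)
    (e : Fin n → Fin N → Fin N → Module.End ℂ M) (_ : ∀ j, Gl (e j))
    (_ : ∀ i j, i ≠ j → ∀ a b c d v, e i a b (e j c d v) = e j c d (e i a b v))
    (u : ℂ) (x y c b : Fin N) (v : M),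
    (∑ j, e j x y) (TC z e u c b v) = TC z e u c b ((∑ j, e j x y) v)
      + (if y = b then TC z e u c x v else 0) - (if x = c then TC z e u y b v else 0)
  | 0, z, e, hg, hc, u, x, y, c, b, v => by
    simp only [TC_zero_apply, Finset.univ_eq_empty, Finset.sum_empty, LinearMap.zero_apply]
    by_cases h1 : y = b <;> by_cases h2 : x = c <;> simp_all [eq_comm]
  | n + 1, z, e, hg, hc, u, x, y, c, b, v => by
    have ih := TC_equiv (fun j => z j.castSucc) (fun j => e j.castSucc) (fun j => hg _)
      (fun i j hij => hc _ _ (by simpa using hij)) u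
    have c1 : ∀ k w, e (Fin.last n) x y
        (TC (fun j => z j.castSucc) (fun j => e j.castSucc) u k b w) =
        TC (fun j => z j.castSucc) (fun j => e j.castSucc) u k b (e (Fin.last n) x y w) := by
      intro k w
      refine (TC_intertwine (e (Fin.last n) x y) _ _ _ (fun j a' b' g => ?_) u k b w).symm
      exact hc _ _ (Fin.castSucc_lt_last j).ne _ _ _ _ _
    have c2 : ∀ k w, (∑ j : Fin n, e j.castSucc x y)
        (LL (z (Fin.last n)) (e (Fin.last n)) u c k w) =
        LL (z (Fin.last n)) (e (Fin.last n)) u c k ((∑ j : Fin n, e j.castSucc x y) w) := by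
      intro k w
      simp only [LL_apply, LinearMap.sum_apply, map_add, map_smul, map_sum]
      rw [Finset.sum_add_distrib, Finset.smul_sum]
      congr 1
      · split_ifs <;> simp
      · exact Finset.sum_congr rfl fun j _ => by
          rw [hc _ _ (Fin.castSucc_lt_last j).ne]
    simp only [TC_succ_apply, Fin.sum_univ_castSucc, LinearMap.add_apply, map_sum, map_add]
    simp only [c2, ih, LL_equiv _ _ (hg _), c1, map_add, map_sub, Finset.sum_add_distrib,
      Finset.sum_sub_distrib]
    have r1 : ∀ (L : Fin N → Module.End ℂ M) (p : Prop) [Decidable p] (T : Fin N → M),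
        ∑ k, L k (if p then T k else 0) = if p then ∑ k, L k (T k) else 0 := by
      intro L p _ T; split_ifs <;> simp
    have r2 : ∀ (L : Fin N → Module.End ℂ M) (T : M),
        ∑ k, L k (if x = k then T else 0) = L x T := by
      intro L T
      rw [Finset.sum_eq_single x] <;> simp +contextual [eq_comm]
    have r3 : ∀ (p : Prop) [Decidable p] (T : Fin N → M),
        ∑ k, (if p then T k else 0) = if p then ∑ k, T k else 0 := by
      intro p _ T; split_ifs <;> simp
    simp only [r1, r2, r3, Finset.sum_ite_eq, Finset.mem_univ, if_true]
    abel

section YY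
variable {N : ℕ} {M : Type*} [AddCommGroup M] [Module ℂ M] (e : Fin N → Fin N → Module.End ℂ M)

/-- Operator `y ↦ (∑ b, e_cb y_b)_c`. -/
def Eop : Module.End ℂ (Fin N → M) :=
  LinearMap.pi fun c => ∑ b, (e c b) ∘ₗ LinearMap.proj b

/-- Twisted action on `Fin N → M`. -/
def eY (x y : Fin N) : Module.End ℂ (Fin N → M) :=
  LinearMap.pi fun c => (e x y) ∘ₗ (LinearMap.proj c : (Fin N → M) →ₗ[ℂ] M) -
    if c = y then (LinearMap.proj x : (Fin N → M) →ₗ[ℂ] M) else 0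

/-- Componentwise action. -/
def cw (f : Module.End ℂ M) : Module.End ℂ (Fin N → M) :=
  LinearMap.pi fun c => f ∘ₗ LinearMap.proj c

lemma Eop_apply (y : Fin N → M) (c : Fin N) : Eop e y c = ∑ b, e c b (y b) := by
  simp [Eop]

lemma eY_apply (x y : Fin N) (g : Fin N → M) (c : Fin N) :
    eY e x y g c = e x y (g c) - if c = y then g x else 0 := by
  unfold eY; by_cases h : c = y <;> simp [h]

lemma cw_apply (f : Module.End ℂ M) (g : Fin N → M) (c : Fin N) : cw f g c = f (g c) := by
  simp [cw]

variable {e}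

lemma Eop_eY (he : Gl e) (x y : Fin N) (g : Fin N → M) :
    eY e x y (Eop e g) = Eop e (eY e x y g) := by
  funext c
  simp only [Eop_apply, eY_apply, map_sub, map_sum, Finset.sum_sub_distrib]
  have h : ∀ b, e x y (e c b (g b)) = e c b (e x y (g b)) - (if x = b then e c y (g x) else 0)
      + (if c = y then e x b (g b) else 0) := by
    intro b
    have := he c b x y (g b)
    rw [sub_eq_iff_eq_add] at this
    rw [this]
    by_cases h1 : x = b <;> by_cases h2 : c = y <;> simp_all [eq_comm] <;> abel
  simp only [h, Finset.sum_add_distrib, Finset.sum_sub_distrib, Finset.sum_ite_eq,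
    Finset.mem_univ, if_true]
  have r : ∀ b, e c b (if b = y then g x else 0) = if b = y then e c y (g x) else 0 := by
    intro b; by_cases h : b = y <;> simp [h]
  simp only [r, Finset.sum_ite_eq', Finset.mem_univ, if_true]
  split_ifs <;> simp

lemma eY_gl (he : Gl e) : Gl (eY e) := by
  intro a b c d g
  funext k
  have h := he a b c d (g k)
  rw [sub_eq_iff_eq_add] at h
  have r : ∀ (p : Prop) [Decidable p] (f : Fin N → M), (if p then f else 0) k
      = if p then f k else 0 := by intro p _ f; split_ifs <;> simp
  simp only [Pi.sub_apply, r, eY_apply, map_sub, h]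
  have r2 : ∀ (p : Prop) [Decidable p] (f : Module.End ℂ M) (w : M), f (if p then w else 0)
      = if p then f w else 0 := by intro p _ f w; split_ifs <;> simp
  simp only [r2]
  by_cases h1 : b = c <;> by_cases h2 : d = a <;> by_cases h3 : k = b <;> by_cases h4 : k = d <;>
    simp [h1, h2, h3, h4] <;> simp_all [eq_comm] <;> abel

lemma Eop_cw (f : Module.End ℂ M) (hf : ∀ a b v, f (e a b v) = e a b (f v)) (g : Fin N → M) :
    cw f (Eop e g) = Eop e (cw f g) := by
  funext c; simp [cw_apply, Eop_apply, hf]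

lemma eY_cw (f : Module.End ℂ M) (hf : ∀ a b v, f (e a b v) = e a b (f v)) (x y : Fin N)
    (g : Fin N → M) : cw f (eY e x y g) = eY e x y (cw f g) := by
  funext c; simp only [cw_apply, eY_apply, map_sub, hf]; split_ifs <;> simp

lemma eY_sum (b : Fin N) (g : Fin N → M) :
    ∑ c, eY e b c g c = Eop e g b - (N : ℂ) • g b := by
  simp [eY_apply, Eop_apply, Finset.sum_sub_distrib, Nat.cast_smul_eq_nsmul]

lemma aeval_intertwine {X : Type*} [AddCommGroup X] [Module ℂ X] (x : X →ₗ[ℂ] M)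
    (f : Module.End ℂ M) (h : Module.End ℂ X) (hx : ∀ g, f (x g) = x (h g))
    (p : Polynomial ℂ) (g : X) :
    (Polynomial.aeval f p) (x g) = x ((Polynomial.aeval h p) g) := by
  induction p using Polynomial.induction_on' generalizing g with
  | add p q hp hq => simp [hp, hq]
  | monomial k r =>
    simp only [Polynomial.aeval_monomial, Module.End.mul_apply, Module.algebraMap_end_apply,
      map_smul]
    congr 1
    induction k generalizing g with
    | zero => simp
    | succ k ih => rw [pow_succ, pow_succ, Module.End.mul_apply, hx, ih,
        Module.End.mul_apply]

lemma nnp_succ (K : ℕ) : nnp (K + 1) = nnp K * (Polynomial.X - Polynomial.C (K : ℂ)) := by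
  simp [nnp, Finset.prod_range_succ]

lemma nnp_succ' (K : ℕ) : nnp (K + 1) = Polynomial.X * (nnp K).comp (Polynomial.X - 1) := by
  simp only [nnp, Finset.prod_range_succ', Polynomial.prod_comp]
  rw [mul_comm]
  congr 1
  · simp
  · refine Finset.prod_congr rfl fun k _ => ?_
    simp; ring

lemma nn_neg {f : Module.End ℂ M} {K : ℕ} (hK : Polynomial.aeval f (nnp K) = 0) {v : M}
    (hv : f v = -v) : v = 0 := by
  have h1 : ∀ p : Polynomial ℂ, Polynomial.aeval f p v = p.eval (-1) • v := by
    intro p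
    exact Module.End.aeval_apply_of_mem_apply_eq_smul (by simp [hv])
  have h2 := h1 (nnp K)
  rw [hK] at h2
  have : (nnp K).eval (-1) ≠ 0 := by
    rw [nnp, Polynomial.eval_prod, Finset.prod_ne_zero_iff]
    intro k _ h
    simp at h
    have : ((k + 1 : ℕ) : ℂ) = 0 := by push_cast; linear_combination -h
    exact absurd (Nat.cast_eq_zero.mp this) (by omega)
  simpa [this] using h2.symm

lemma nn_kill (he : Gl e) {a : Fin N} {K : ℕ} (hK : Polynomial.aeval (e a a) (nnp K) = 0) {v : M}
    (hv : e a a v = 0) (c : Fin N) : e c a v = 0 := by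
  by_cases hc : c = a
  · rw [hc, hv]
  · apply nn_neg hK
    have := he a a c a v
    simpa [hv, hc, Ne.symm hc] using this

lemma nn_X (he : Gl e) {a : Fin N} {K : ℕ} (hK : Polynomial.aeval (e a a) (nnp K) = 0)
    (y : Fin N → M) : Polynomial.aeval (eY e a a) (nnp K) (Eop e y) = 0 := by
  rw [aeval_intertwine (Eop e) _ (eY e a a) (fun g => Eop_eY he a a g)]
  set y' := Polynomial.aeval (eY e a a) (nnp K) y with hy'
  have h1 : ∀ c, c ≠ a → y' c = 0 := by
    intro c hc
    have := aeval_intertwine (LinearMap.proj c : (Fin N → M) →ₗ[ℂ] M) (e a a) (eY e a a)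
      (fun g => by simp [eY_apply, hc]) (nnp K) y
    rw [hK] at this
    simpa using this.symm
  have h2 : e a a (y' a) = 0 := by
    have := aeval_intertwine (LinearMap.proj a : (Fin N → M) →ₗ[ℂ] M) (e a a - 1) (eY e a a)
      (fun g => by simp [eY_apply]) (nnp K) y
    simp only [LinearMap.proj_apply, ← hy'] at this
    rw [← this]
    have h3 : Polynomial.aeval (e a a) (nnp (K + 1)) = 0 := by
      rw [nnp_succ, map_mul, hK, zero_mul]
    rw [nnp_succ', map_mul, Polynomial.aeval_comp] at h3
    simp only [Polynomial.aeval_X, map_sub, map_one] at h3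
    exact LinearMap.congr_fun h3 (y a)
  funext c
  rw [Eop_apply, Finset.sum_eq_single a]
  · exact nn_kill he hK h2 c
  · intro b _ hb; rw [h1 b hb, map_zero]
  · simp

end YY

end XXXModel

namespace XXXModel

/-- Vector-valued polynomial functions of degree `< d`. -/
def PolyLT (M : Type*) [AddCommGroup M] [Module ℂ M] (d : ℕ) : Submodule ℂ (ℂ → M) where
  carrier := {f | ∃ w : ℕ → M, ∀ u, f u = ∑ i ∈ Finset.range d, u ^ i • w i}
  add_mem' := by
    rintro f g ⟨w, hw⟩ ⟨w', hw'⟩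
    exact ⟨w + w', fun u => by simp [hw, hw', Finset.sum_add_distrib]⟩
  zero_mem' := ⟨0, fun u => by simp⟩
  smul_mem' := by
    rintro c f ⟨w, hw⟩
    exact ⟨c • w, fun u => by
      simp only [Pi.smul_apply, hw, Finset.smul_sum]
      exact Finset.sum_congr rfl fun i _ => smul_comm _ _ _⟩

section
variable {M X : Type*} [AddCommGroup M] [Module ℂ M] [AddCommGroup X] [Module ℂ X]

lemma PolyLT_mono {d d' : ℕ} (h : d ≤ d') {f : ℂ → M} (hf : f ∈ PolyLT M d) :
    f ∈ PolyLT M d' := by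
  obtain ⟨w, hw⟩ := hf
  refine ⟨fun i => if i < d then w i else 0, fun u => ?_⟩
  rw [hw]
  rw [← Finset.sum_subset (Finset.range_mono h)]
  · exact Finset.sum_congr rfl fun i hi => by simp only [if_pos (Finset.mem_range.mp hi)]
  · intro i _ hi
    have : ¬ i < d := by simpa using hi
    simp only [if_neg this, smul_zero]

lemma PolyLT_zero {f : ℂ → M} (hf : f ∈ PolyLT M 0) (u : ℂ) : f u = 0 := by
  obtain ⟨w, hw⟩ := hf; simp [hw]

lemma PolyLT_map (x : X →ₗ[ℂ] M) {d : ℕ} {f : ℂ → X} (hf : f ∈ PolyLT X d) :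
    (fun u => x (f u)) ∈ PolyLT M d := by
  obtain ⟨w, hw⟩ := hf
  exact ⟨fun i => x (w i), fun u => by simp [hw]⟩

lemma PolyLT_mul {d : ℕ} {f : ℂ → M} (hf : f ∈ PolyLT M d) :
    (fun u => u • f u) ∈ PolyLT M (d + 1) := by
  obtain ⟨w, hw⟩ := hf
  refine ⟨fun i => if i = 0 then 0 else w (i - 1), fun u => ?_⟩
  rw [Finset.sum_range_succ']
  simp [hw, Finset.smul_sum, smul_smul, pow_succ']

/-- In case `d = 0`, multiplication by `u` still gives zero. -/
lemma PolyLT_mul' {d D : ℕ} (h : d = 0 ∨ d + 1 ≤ D) {f : ℂ → M} (hf : f ∈ PolyLT M d) :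
    (fun u => u • f u) ∈ PolyLT M D := by
  rcases h with rfl | h
  · have : (fun u => u • f u) = 0 := by funext u; simp [PolyLT_zero hf]
    rw [this]; exact Submodule.zero_mem _
  · exact PolyLT_mono h (PolyLT_mul hf)
end

/-- Solvability of the difference system with prescribed leading coefficient. -/
def Sol {N n : ℕ} {M : Type*} [AddCommGroup M] [Module ℂ M] (a : Fin N) (ρ : Fin N → ℂ)
    (z : Fin n → ℂ) (e : Fin n → Fin N → Fin N → Module.End ℂ M) (m : Fin N → ℕ) (v0 : M) : Prop :=
  ∃ φ : (Fin N → ℕ) → ℂ → M, Sys a ρ (fun u => ∀ j, u ≠ z j) (TC z e) φ ∧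
    (∀ α, φ α ∈ PolyLT M (m a + 1 - ∑ k, α k)) ∧
    ((fun u => φ 0 u - u ^ (m a) • v0) ∈ PolyLT M (m a)) ∧
    ∀ α b u, (∑ j, e j b b) (φ α u) =
      ((m b : ℂ) + α b - if b = a then ((∑ k, α k : ℕ) : ℂ) else 0) • φ α u

section
variable {N n : ℕ} {M X : Type*} [AddCommGroup M] [Module ℂ M] [AddCommGroup X] [Module ℂ X]
  {a : Fin N} {ρ : Fin N → ℂ} {z : Fin n → ℂ} {e : Fin n → Fin N → Fin N → Module.End ℂ M}
  {m : Fin N → ℕ}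

lemma Sol_add {v w : M} (hv : Sol a ρ z e m v) (hw : Sol a ρ z e m w) :
    Sol a ρ z e m (v + w) := by
  obtain ⟨φ, h1, h2, h3, h4⟩ := hv
  obtain ⟨φ', h1', h2', h3', h4'⟩ := hw
  refine ⟨fun α u => φ α u + φ' α u, ?_, fun α => Submodule.add_mem _ (h2 α) (h2' α), ?_, ?_⟩
  · intro α b u hu
    simp only [h1 α b u hu, h1' α b u hu, map_add, smul_add, Finset.sum_add_distrib]
  · convert Submodule.add_mem _ h3 h3' using 1
    funext u; simp only [Pi.add_apply, smul_add]; abel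
  · intro α b u; rw [map_add, h4, h4', smul_add]

lemma Sol_smul (c : ℂ) {v : M} (hv : Sol a ρ z e m v) : Sol a ρ z e m (c • v) := by
  obtain ⟨φ, h1, h2, h3, h4⟩ := hv
  refine ⟨fun α u => c • φ α u, ?_, fun α => Submodule.smul_mem _ c (h2 α), ?_, ?_⟩
  · intro α b u hu
    simp only [h1 α b u hu, map_smul, Finset.smul_sum]
    exact Finset.sum_congr rfl fun i _ => smul_comm _ _ _
  · convert Submodule.smul_mem _ c h3 using 1
    funext u; simp only [Pi.smul_apply, smul_sub]; rw [smul_comm c]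
  · intro α b u; rw [map_smul, h4, smul_comm]

lemma Sol_zero : Sol a ρ z e m (0 : M) :=
  ⟨fun _ _ => (0 : M), fun _ _ _ _ => by simp, fun _ => Submodule.zero_mem _,
    by convert Submodule.zero_mem (PolyLT M (m a)) using 1; funext u; simp, by simp⟩

lemma Sol_sum {ι : Type*} (s : Finset ι) (v : ι → M) (h : ∀ i ∈ s, Sol a ρ z e m (v i)) :
    Sol a ρ z e m (∑ i ∈ s, v i) := by
  classical
  induction s using Finset.induction_on with
  | empty => simpa using Sol_zero
  | insert i s hi ih =>
    rw [Finset.sum_insert hi]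
    exact Sol_add (h i (by simp)) (ih fun j hj => h j (by simp [hj]))

end

/-- Data relating a chain on `M` to one on `X`. -/
structure Rel {N n : ℕ} {M X : Type*} [AddCommGroup M] [Module ℂ M] [AddCommGroup X] [Module ℂ X]
    (e : Fin (n + 1) → Fin N → Fin N → Module.End ℂ M)
    (eX : Fin (n + 1) → Fin N → Fin N → Module.End ℂ X)
    (x : Fin N → X →ₗ[ℂ] M) (Θ : Module.End ℂ X) : Prop where
  last : ∀ p q d g, e (Fin.last n) p q (x d g) = x d (eX (Fin.last n) p q g) +
    if d = q then x p g else 0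
  other : ∀ (j : Fin n) p q d g, e j.castSucc p q (x d g) = x d (eX j.castSucc p q g)
  sum : ∀ b g, ∑ c, x c (eX (Fin.last n) b c g) = x b (Θ g)
  Θc : ∀ j p q g, eX j p q (Θ g) = Θ (eX j p q g)

section
variable {N n : ℕ} {M X : Type*} [AddCommGroup M] [Module ℂ M] [AddCommGroup X] [Module ℂ X]
  {a : Fin N} {ρ : Fin N → ℂ} {z : Fin (n + 1) → ℂ}
  {e : Fin (n + 1) → Fin N → Fin N → Module.End ℂ M}
  {eX : Fin (n + 1) → Fin N → Fin N → Module.End ℂ X}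
  {x : Fin N → X →ₗ[ℂ] M} {Θ : Module.End ℂ X} {m : Fin N → ℕ}

lemma Rel.hTM (h : Rel e eX x Θ) (u : ℂ) (c b k : Fin N) (g : X) :
    TC z e u c b (x k g) = x k (TC z eX u c b g) +
      if c = k then (u - z (Fin.last n))⁻¹ • ∑ d, x d
        (TC (fun j => z j.castSucc) (fun j => eX j.castSucc) u d b g) else 0 := by
  rw [TC_succ_apply, TC_succ_apply, map_sum]
  have h1 := fun d => TC_intertwine (x k) (fun j => z j.castSucc) (fun j => e j.castSucc)
    (fun j => eX j.castSucc) (fun j p q g => h.other j p q k g) u d b g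
  simp only [h1, LL_apply, h.last, map_add, map_smul, smul_add]
  have h2 : ∀ (p : Prop) [Decidable p] (w : X), x k (if p then w else 0) =
    if p then x k w else 0 := by intro p _ w; split_ifs <;> simp
  simp only [h2, Finset.sum_add_distrib, Finset.smul_sum]
  by_cases hc : c = k
  · simp [hc, add_assoc]
  · simp [hc, Ne.symm hc]

lemma Rel.hT2 (h : Rel e eX x Θ) (u : ℂ) (hu : u ≠ z (Fin.last n)) (b : Fin N) (g : X) :
    (u - z (Fin.last n))⁻¹ • ∑ d, x d
      (TC (fun j => z j.castSucc) (fun j => eX j.castSucc) u d b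
        ((u - z (Fin.last n)) • g + Θ g)) = ∑ d, x d (TC z eX u d b g) := by
  have h1 := fun d => TC_intertwine Θ (fun j => z j.castSucc) (fun j => eX j.castSucc)
    (fun j => eX j.castSucc) (fun j p q g => h.Θc _ p q g) u d b g
  have h0 : u - z (Fin.last n) ≠ 0 := sub_ne_zero.mpr hu
  simp only [map_add, map_smul, h1, ← h.sum, Finset.sum_add_distrib, smul_add, ← Finset.smul_sum,
    smul_smul, inv_mul_cancel₀ h0, one_smul, TC_succ_apply, LL_apply, map_sum]
  congr 1
  · refine Finset.sum_congr rfl fun d _ => ?_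
    rw [Finset.sum_eq_single d] <;> simp +contextual [eq_comm]
  · congr 1
    exact Finset.sum_comm

lemma Rel.tot (h : Rel e eX x Θ) (p q d : Fin N) (g : X) :
    (∑ j, e j p q) (x d g) = x d ((∑ j, eX j p q) g) + if d = q then x p g else 0 := by
  simp only [Fin.sum_univ_castSucc, LinearMap.add_apply, LinearMap.sum_apply, h.last, h.other,
    map_add, map_sum]
  abel

lemma sum_up_ge (α : Fin N → ℕ) (c : Fin N) : ∑ k, α k ≤ ∑ k, up a α c k :=
  Finset.sum_le_sum fun k _ => by unfold up; split_ifs <;> omega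

lemma sum_up (α : Fin N → ℕ) (c : Fin N) (hc : c ≠ a) :
    ∑ k, up a α c k = ∑ k, α k + 1 := by
  have : ∀ k, up a α c k = α k + if k = c then 1 else 0 := by
    intro k; unfold up; by_cases h : k = c <;> simp [h, hc]
  simp [this, Finset.sum_add_distrib]

lemma sum_dn (α : Fin N → ℕ) (c : Fin N) (hc : α c ≠ 0) :
    ∑ k, dn α c k + 1 = ∑ k, α k := by
  have : ∀ k, α k = dn α c k + if k = c then 1 else 0 := by
    intro k; unfold dn; by_cases h : k = c <;> simp [h]; omega
  rw [Finset.sum_congr rfl fun k _ => this k]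
  simp [Finset.sum_add_distrib]

lemma step_ne (h : Rel e eX x Θ) (hρ : ρ a = 1) {l : Fin N} (hl : l ≠ a) {v : X}
    (hs : Sol a ρ z eX m v) :
    Sol a ρ z e (fun b => m b + if b = l then 1 else 0) (x l v) := by
  obtain ⟨φ, h1, h2, h3, h4⟩ := hs
  have hC := combine a ρ (fun u => ∀ j, u ≠ z j) x (TC z eX)
    (TC (fun j => z j.castSucc) (fun j => eX j.castSucc)) (TC z e) Θ (z (Fin.last n))
    (fun u _ c b k g => h.hTM u c b k g) (fun u hu b g => h.hT2 u (hu _) b g)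
    (fun α k u => (if k = l then φ α u else 0) - if k = a then ρ l • φ (up a α l) u else 0)
    (fun _ _ => 0) (by
      intro α b k u hu
      by_cases k1 : k = l
      · subst k1; simp [hl, h1 α b u hu]
      · by_cases k2 : k = a
        · subst k2
          have := h1 (up k α l) b u hu
          simp only [Ne.symm hl, if_false, if_true, zero_sub, map_neg, map_smul, smul_neg,
            map_zero, add_zero, Finset.sum_neg_distrib, up_comm k α _ l, this, Finset.smul_sum]
          simp only [smul_comm (ρ l)]
        · simp [k1, k2]) (by
      intro α v
      simp only [smul_sub, Finset.sum_sub_distrib, smul_ite, smul_zero, Finset.sum_ite_eq',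
        Finset.mem_univ, if_true, up_self, hρ, one_smul, map_zero, add_zero, sub_self])
  have hE : ∀ α u, ∑ k, x k ((if k = l then φ α u else 0) -
      if k = a then ρ l • φ (up a α l) u else 0) = x l (φ α u) - ρ l • x a (φ (up a α l) u) := by
    intro α u
    have h2 : ∀ k (p : Prop) [Decidable p] (w : X), x k (if p then w else 0) =
      if p then x k w else 0 := by intro k p _ w; split_ifs <;> simp
    simp [h2, Finset.sum_sub_distrib]
  simp only [hE] at hC
  refine ⟨_, hC, ?_, ?_, ?_⟩
  · intro α
    refine Submodule.sub_mem _ ?_ ?_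
    · simpa [Ne.symm hl] using PolyLT_map (x l) (h2 α)
    · refine Submodule.smul_mem _ (ρ l) (PolyLT_mono ?_ (PolyLT_map (x a) (h2 (up a α l))))
      have := sum_up_ge (a := a) α l
      simp only [Ne.symm hl, if_false]
      omega
  · have : (fun u => x l (φ 0 u) - ρ l • x a (φ (up a 0 l) u) -
        u ^ (m a + if a = l then 1 else 0) • x l v) =
        (fun u => x l (φ 0 u - u ^ (m a) • v)) - ρ l • (fun u => x a (φ (up a 0 l) u)) := by
      funext u
      simp only [Ne.symm hl, if_false, Pi.sub_apply, Pi.smul_apply, map_sub, map_smul, add_zero]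
      abel
    rw [this]
    simp only [Ne.symm hl, if_false, add_zero]
    refine Submodule.sub_mem _ (PolyLT_map _ h3) (Submodule.smul_mem _ _ (PolyLT_map _ ?_))
    refine PolyLT_mono ?_ (h2 _)
    rw [sum_up _ _ hl]; simp
  · intro α b u
    simp only [map_sub, map_smul, h.tot, h4, sum_up α l hl]
    have hup : ((up a α l b : ℕ) : ℂ) = α b + if b = l then 1 else 0 := by
      unfold up; by_cases hb : b = l <;> simp [hb, hl]
    rw [hup]
    by_cases hb : b = l
    · subst hb; simp [hl, Ne.symm hl]; module
    · by_cases hb' : b = a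
      · subst hb'; simp [hl, Ne.symm hl]; module
      · simp [hb, hb', Ne.symm hb, Ne.symm hb']; module

lemma tot_gl {n : ℕ} {eX : Fin n → Fin N → Fin N → Module.End ℂ X} (hgl : ∀ j, Gl (eX j))
    (hcm : ∀ i j, i ≠ j → ∀ a b c d v, eX i a b (eX j c d v) = eX j c d (eX i a b v)) :
    Gl (fun p q => ∑ j, eX j p q) := by
  intro a b c d v
  simp only [LinearMap.sum_apply, map_sum]
  rw [Finset.sum_comm, ← Finset.sum_sub_distrib]
  have : ∀ j, ∑ i, eX j a b (eX i c d v) - ∑ i, eX i c d (eX j a b v) =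
      (if b = c then eX j a d v else 0) - (if d = a then eX j c b v else 0) := by
    intro j
    rw [← hgl j, ← Finset.sum_sub_distrib, Finset.sum_eq_single j]
    · intro i _ hij; rw [hcm j i hij.symm, sub_self]
    · simp
  rw [Finset.sum_congr rfl fun j _ => this j, Finset.sum_sub_distrib]
  congr 1 <;> split_ifs <;> simp

lemma step_self (h : Rel e eX x Θ) (hgl : ∀ j, Gl (eX j))
    (hcm : ∀ i j, i ≠ j → ∀ a b c d v, eX i a b (eX j c d v) = eX j c d (eX i a b v))
    (hρ : ρ a = 1) (hρ1 : ∀ k, k ≠ a → ρ k ≠ 1) {v : X}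
    (hs : Sol a ρ z eX m v) :
    Sol a ρ z e (fun b => m b + if b = a then 1 else 0) (x a v) := by
  obtain ⟨φ, h1, h2, h3, h4⟩ := hs
  set β : Fin N → ℂ := fun k => if k = a then 0 else (ρ k - 1)⁻¹ with hβ
  have hβa : β a = 0 := by simp [hβ]
  have hβk : ∀ k, k ≠ a → β k * (ρ k - 1) = 1 := by
    intro k hk
    simp only [hβ, hk, if_false]
    exact inv_mul_cancel₀ (sub_ne_zero.mpr (hρ1 k hk))
  set G : Fin N → Module.End ℂ X := fun k => ∑ j, eX j a k with hGdef
  have hG : ∀ u, (∀ j, u ≠ z j) → ∀ c b k g, TC z eX u c b (G k g) = G k (TC z eX u c b g)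
      - (if k = b then TC z eX u c a g else 0) + (if c = a then TC z eX u k b g else 0) := by
    intro u _ c b k g
    have := TC_equiv z eX hgl hcm u a k c b g
    simp only [hGdef, this, eq_comm (a := c) (b := a)]
    abel
  have hΘ : ∀ u, (∀ j, u ≠ z j) → ∀ c b g, TC z eX u c b (Θ g) = Θ (TC z eX u c b g) :=
    fun u _ c b g => TC_intertwine Θ _ _ _ h.Θc u c b g
  have hC := combine a ρ (fun u => ∀ j, u ≠ z j) x (TC z eX)
    (TC (fun j => z j.castSucc) (fun j => eX j.castSucc)) (TC z e) Θ (z (Fin.last n))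
    (fun u _ c b k g => h.hTM u c b k g) (fun u hu b g => h.hT2 u (hu _) b g)
    (psi a ρ β G Θ (z (Fin.last n)) φ) φ
    (fun α b k u hu => psi_p1 a ρ β hρ hβa hβk _ _ G Θ _ hG hΘ φ h1 α b k u hu)
    (fun α v => psi_trace a ρ β hρ hβa G Θ _ φ α v)
  have hdn : ∀ (α : Fin N → ℕ) (k : Fin N), (α k : ℂ) • (fun u => φ (dn α k) u) ∈
      PolyLT X (m a + 2 - ∑ k, α k) := by
    intro α k
    by_cases hk : α k = 0
    · simp [hk]
    · refine Submodule.smul_mem _ _ (PolyLT_mono ?_ (h2 _))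
      have := sum_dn α k hk
      omega
  have hpk : ∀ (α : Fin N → ℕ) (k : Fin N), (fun u => β k • (G k (φ α u) -
      (α k : ℂ) • φ (dn α k) u)) ∈ PolyLT X (m a + 2 - ∑ k, α k) := by
    intro α k
    exact Submodule.smul_mem _ _ (Submodule.sub_mem _
      (PolyLT_mono (by omega) (PolyLT_map (G k) (h2 α))) (hdn α k))
  have hr : ∀ (α : Fin N → ℕ) (c : ℂ), (fun u => c • φ α u + Θ (φ α u) -
      ∑ l, (β l * ρ l) • G l (φ (up a α l) u)) ∈ PolyLT X (m a + 1 - ∑ k, α k) := by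
    intro α c
    refine Submodule.sub_mem _ (Submodule.add_mem _ (Submodule.smul_mem _ _ (h2 α))
      (PolyLT_map Θ (h2 α))) ?_
    have : (fun u => ∑ l, (β l * ρ l) • G l (φ (up a α l) u)) =
        ∑ l, (β l * ρ l) • fun u => G l (φ (up a α l) u) := by
      funext u; simp
    rw [this]
    refine Submodule.sum_mem _ fun l _ => Submodule.smul_mem _ _ (PolyLT_map _
      (PolyLT_mono ?_ (h2 _)))
    have := sum_up_ge (a := a) α l
    omega
  have hrw : ∀ (α : Fin N → ℕ), psi a ρ β G Θ (z (Fin.last n)) φ α a = fun u => u • φ α u +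
      ((1 - z (Fin.last n) + ∑ l, β l * ρ l + ∑ l, β l * ρ l * α l) • φ α u + Θ (φ α u) -
      ∑ l, (β l * ρ l) • G l (φ (up a α l) u)) := by
    intro α
    funext u
    rw [psi_self _ _ hβa]
    module
  refine ⟨_, hC, ?_, ?_, ?_⟩
  · intro α
    have hm : (m a + if a = a then 1 else 0) + 1 = m a + 2 := by simp
    rw [hm]
    have : (fun u => ∑ k, x k (psi a ρ β G Θ (z (Fin.last n)) φ α k u)) =
        ∑ k, fun u => x k (psi a ρ β G Θ (z (Fin.last n)) φ α k u) := by
      funext u; simp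
    rw [this]
    refine Submodule.sum_mem _ fun k _ => PolyLT_map _ ?_
    by_cases hk : k = a
    · subst hk
      rw [hrw]
      refine Submodule.add_mem _ (PolyLT_mul' ?_ (h2 α)) (PolyLT_mono ?_ (hr α _))
      · omega
      · omega
    · have : psi a ρ β G Θ (z (Fin.last n)) φ α k = _ :=
        funext fun u => psi_of_ne ρ β G Θ (z (Fin.last n)) φ α k u hk
      rw [this]
      exact hpk α k
  · simp only [if_true]
    have : (fun u => ∑ k, x k (psi a ρ β G Θ (z (Fin.last n)) φ 0 k u) -
        u ^ (m a + 1) • x a v) =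
        ∑ k, fun u => x k (psi a ρ β G Θ (z (Fin.last n)) φ 0 k u -
          if k = a then u ^ (m a + 1) • v else 0) := by
      funext u
      have h2 : ∀ k (p : Prop) [Decidable p] (w : X), x k (if p then w else 0) =
        if p then x k w else 0 := by intro k p _ w; split_ifs <;> simp
      simp [map_sub, Finset.sum_sub_distrib, h2]
    rw [this]
    refine Submodule.sum_mem _ fun k _ => PolyLT_map _ ?_
    by_cases hk : k = a
    · subst hk
      have : (fun u => psi k ρ β G Θ (z (Fin.last n)) φ 0 k u -
          if k = k then u ^ (m k + 1) • v else 0) =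
          (fun u => u • (φ 0 u - u ^ (m k) • v)) + fun u =>
      ((1 - z (Fin.last n) + ∑ l, β l * ρ l +
        ∑ l, β l * ρ l * ((0 : Fin N → ℕ) l)) • φ 0 u + Θ (φ 0 u) -
      ∑ l, (β l * ρ l) • G l (φ (up k 0 l) u)) := by
        funext u
        rw [hrw]
        simp only [if_true, Pi.add_apply, smul_sub, smul_smul, pow_succ']
        abel
      rw [this]
      exact Submodule.add_mem _ (PolyLT_mul h3) (by simpa using hr 0 _)
    · have : (fun u => psi a ρ β G Θ (z (Fin.last n)) φ 0 k u -
          if k = a then u ^ (m a + 1) • v else 0) = fun u => β k • G k (φ 0 u) := by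
        funext u
        rw [psi_of_ne ρ β G Θ (z (Fin.last n)) φ 0 k u hk]; simp [hk]
      rw [this]
      exact Submodule.smul_mem _ _ (PolyLT_map _ (by simpa using h2 0))
  · intro α b u
    have hGw : ∀ k w (c : ℂ), (∑ j, eX j b b) w = c • w → (∑ j, eX j b b) (G k w) =
        (c + (if b = a then 1 else 0) - (if b = k then 1 else 0)) • G k w := by
      intro k w c hw
      have := tot_gl hgl hcm b b a k w
      rw [hw, sub_eq_iff_eq_add] at this
      simp only [hGdef]
      rw [this, map_smul]
      by_cases b1 : b = a
      · subst b1
        by_cases b2 : k = b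
        · subst b2; simp
        · simp [b2, Ne.symm b2]; module
      · by_cases b2 : k = b
        · subst b2; simp [b1]; module
        · simp [b1, b2, Ne.symm b2]
    set lam : ℂ := (m b : ℂ) + α b - if b = a then ((∑ k, α k : ℕ) : ℂ) else 0 with hlam
    have hΛ : (((m b + if b = a then 1 else 0 : ℕ) : ℂ) + α b -
        if b = a then ((∑ k, α k : ℕ) : ℂ) else 0) = lam + if b = a then 1 else 0 := by
      rw [hlam]; split_ifs <;> push_cast <;> ring
    have hw0 : (∑ j, eX j b b) (φ α u) = lam • φ α u := h4 α b u
    have hwΘ : (∑ j, eX j b b) (Θ (φ α u)) = lam • Θ (φ α u) := by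
      rw [← map_smul, ← hw0]; simp [LinearMap.sum_apply, h.Θc]
    have hwup : ∀ l, l ≠ a → (∑ j, eX j b b) (φ (up a α l) u) =
        (lam + (if b = l then 1 else 0) - if b = a then 1 else 0) • φ (up a α l) u := by
      intro l hl
      rw [h4, sum_up α l hl]
      congr 1
      have hup : ((up a α l b : ℕ) : ℂ) = α b + if b = l then 1 else 0 := by
        unfold up; by_cases hb : b = l <;> simp [hb, hl]
      rw [hup, hlam]
      by_cases hb : b = a <;> simp [hb] <;> ring
    have hwG : ∀ l, (∑ j, eX j b b) ((β l * ρ l) • G l (φ (up a α l) u)) =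
        lam • (β l * ρ l) • G l (φ (up a α l) u) := by
      intro l
      by_cases hl : l = a
      · simp [hl, hβa]
      · rw [map_smul, hGw l _ _ (hwup l hl), smul_comm]
        have : lam + (if b = l then 1 else 0) - (if b = a then 1 else 0) +
          (if b = a then 1 else 0) - (if b = l then 1 else 0) = lam := by ring
        rw [this]
    have hwdn : ∀ k, k ≠ a → (∑ j, eX j b b) ((α k : ℂ) • φ (dn α k) u) =
        (lam - (if b = k then 1 else 0) + if b = a then 1 else 0) •
          ((α k : ℂ) • φ (dn α k) u) := by
      intro k hk
      by_cases h0 : α k = 0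
      · simp [h0]
      · rw [map_smul, h4, smul_comm]
        congr 1
        have hs : ((∑ l, α l : ℕ) : ℂ) = ((∑ l, dn α k l : ℕ) : ℂ) + 1 := by
          rw [← sum_dn α k h0]; push_cast; ring
        have hd : ((dn α k b : ℕ) : ℂ) = α b - if b = k then 1 else 0 := by
          unfold dn
          by_cases hb : b = k
          · subst hb
            simp only [if_true]
            rw [Nat.cast_sub (by omega)]; simp
          · simp [hb]
        rw [hlam, hd, hs]
        by_cases hb : b = a
        · simp [hb]; ring
        · simp [hb]; ring
    have hkey : ∀ k, (∑ j, eX j b b) (psi a ρ β G Θ (z (Fin.last n)) φ α k u) =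
        (lam + (if b = a then 1 else 0) - if b = k then 1 else 0) •
          psi a ρ β G Θ (z (Fin.last n)) φ α k u := by
      intro k
      by_cases hk : k = a
      · subst hk
        rw [psi_self _ _ hβa, map_sub, map_add, map_smul, hw0, hwΘ, map_sum]
        simp only [hwG, ← Finset.smul_sum]
        module
      · rw [psi_of_ne _ _ _ _ _ _ _ _ _ hk, map_smul, map_sub, hwdn k hk, hGw k _ _ hw0]
        module
    simp only [hΛ, map_sum (∑ j, e j b b), h.tot, hkey, Finset.smul_sum]
    refine Finset.sum_congr rfl fun k _ => ?_
    by_cases hk : k = b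
    · subst hk; simp; module
    · simp [hk, Ne.symm hk]

end

end XXXModel

namespace XXXModel

universe w

lemma aeval_restrict_zero {M : Type*} [AddCommGroup M] [Module ℂ M] {W : Submodule ℂ M}
    {f : Module.End ℂ M} {h : Module.End ℂ W} (hf : ∀ g : W, ((h g : W) : M) = f g)
    {p : Polynomial ℂ} (hp : ∀ g : W, Polynomial.aeval f p (g : M) = 0) :
    Polynomial.aeval h p = 0 := by
  ext g
  have := aeval_intertwine W.subtype f h (fun g => (hf g).symm) p g
  simp only [Submodule.subtype_apply] at this
  rw [← this, hp]; rfl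

lemma exists_X {N n : ℕ} {M : Type w} [AddCommGroup M] [Module ℂ M]
    {e : Fin (n + 1) → Fin N → Fin N → Module.End ℂ M} (hC : Chain e) :
    ∃ (X : Type w) (_ : AddCommGroup X) (_ : Module ℂ X)
      (eX : Fin (n + 1) → Fin N → Fin N → Module.End ℂ X) (x : Fin N → X →ₗ[ℂ] M)
      (Θ : Module.End ℂ X) (pd : Fin N → M → X),
      Chain eX ∧ Rel e eX x Θ ∧ (∀ c d v, x d (pd c v) = e (Fin.last n) d c v) ∧
      (∀ p q c v, eX (Fin.last n) p q (pd c v) =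
        pd c (e (Fin.last n) p q v) - if p = c then pd q v else 0) ∧
      (∀ (j : Fin n) p q c v, eX j.castSucc p q (pd c v) = pd c (e j.castSucc p q v)) ∧
      (∀ g, (∀ d, x d g = 0) → g = 0) ∧ (∀ c (r : ℂ) v, pd c (r • v) = r • pd c v) := by
  set E := Eop (e (Fin.last n)) with hE
  set X := LinearMap.range E with hX
  set fY : Fin (n + 1) → Fin N → Fin N → Module.End ℂ (Fin N → M) :=
    fun j p q => if j = Fin.last n then eY (e (Fin.last n)) p q else cw (e j p q) with hfY
  have hgl := hC.gl (Fin.last n)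
  have hcl : ∀ j : Fin (n + 1), j ≠ Fin.last n → ∀ p q a b v,
      e j p q (e (Fin.last n) a b v) = e (Fin.last n) a b (e j p q v) :=
    fun j hj p q a b v => hC.comm j _ hj p q a b v
  have hfl : ∀ p q, fY (Fin.last n) p q = eY (e (Fin.last n)) p q := by simp [hfY]
  have hfo : ∀ j, j ≠ Fin.last n → ∀ p q, fY j p q = cw (e j p q) := by
    intro j hj p q; simp [hfY, hj]
  have hEc : ∀ j p q g, fY j p q (E g) = E (fY j p q g) := by
    intro j p q g
    by_cases hj : j = Fin.last n
    · subst hj; rw [hfl]; exact Eop_eY hgl p q g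
    · rw [hfo j hj]; exact Eop_cw _ (fun a b v => hcl j hj p q a b v) g
  have hinv : ∀ j p q, ∀ g ∈ X, fY j p q g ∈ X := by
    rintro j p q _ ⟨g, rfl⟩
    exact ⟨fY j p q g, (hEc j p q g).symm⟩
  have hΘinv : ∀ g ∈ X, (E - (N : ℂ) • 1) g ∈ X := fun g hg =>
    Submodule.sub_mem _ ⟨g, rfl⟩ (Submodule.smul_mem _ _ hg)
  have hpd : ∀ c v, (fun k => e (Fin.last n) k c v) ∈ X := by
    intro c v
    refine ⟨Pi.single c v, ?_⟩
    funext k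
    rw [hE, Eop_apply, Finset.sum_eq_single c]
    · simp
    · intro b _ hb; simp [hb]
    · simp
  refine ⟨X, inferInstance, inferInstance, fun j p q => (fY j p q).restrict (hinv j p q),
    fun c => LinearMap.proj c ∘ₗ X.subtype, (E - (N : ℂ) • 1).restrict hΘinv,
    fun c v => ⟨_, hpd c v⟩, ⟨?_, ?_, ?_⟩, ⟨?_, ?_, ?_, ?_⟩, ?_, ?_, ?_, ?_, ?_⟩
  · intro j p q c d g
    have : Gl (fY j) := by
      by_cases hj : j = Fin.last n
      · subst hj
        have : fY (Fin.last n) = eY (e (Fin.last n)) := by funext p q; exact hfl p q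
        rw [this]; exact eY_gl hgl
      · intro p q c d g
        rw [hfo j hj, hfo j hj, hfo j hj, hfo j hj]
        funext k
        have := hC.gl j p q c d (g k)
        simp only [Pi.sub_apply, cw_apply, this]
        congr 1 <;> split_ifs <;> simp [cw_apply]
    have h := this p q c d g
    apply Subtype.ext
    simp only [Submodule.coe_sub, LinearMap.coe_restrict_apply]
    rw [h]
    congr 1 <;> split_ifs <;> simp
  · intro i j hij p q c d g
    apply Subtype.ext
    simp only [LinearMap.coe_restrict_apply]
    by_cases hi : i = Fin.last n
    · have hj : j ≠ Fin.last n := fun h => hij (hi.trans h.symm)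
      rw [hi, hfl, hfo j hj]
      exact (eY_cw _ (fun a b v => hcl j hj c d a b v) p q g).symm
    · by_cases hj : j = Fin.last n
      · rw [hj, hfl, hfo i hi]
        exact (eY_cw _ (fun a b v => hcl i hi p q a b v) c d g)
      · rw [hfo i hi, hfo j hj]
        funext k
        simp only [cw_apply]
        exact hC.comm i j hij p q c d _
  · intro j a
    obtain ⟨K, hK⟩ := hC.nn j a
    refine ⟨K, aeval_restrict_zero (f := fY j a a) (fun g => by simp) ?_⟩
    rintro ⟨_, y, rfl⟩
    by_cases hj : j = Fin.last n
    · subst hj; rw [hfl]; exact nn_X hgl hK y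
    · rw [hfo j hj]
      funext k
      have := aeval_intertwine (LinearMap.proj k : (Fin N → M) →ₗ[ℂ] M) (e j a a) (cw (e j a a))
        (fun g => by simp [cw_apply]) (nnp K) (E y)
      rw [hK] at this
      simpa using this.symm
  · intro p q d g
    simp only [LinearMap.comp_apply, Submodule.subtype_apply, LinearMap.coe_restrict_apply, hfl,
      LinearMap.proj_apply, eY_apply]
    abel
  · intro j p q d g
    simp only [LinearMap.comp_apply, Submodule.subtype_apply, LinearMap.coe_restrict_apply,
      hfo _ (Fin.castSucc_lt_last j).ne, LinearMap.proj_apply, cw_apply]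
  · intro b g
    simp only [LinearMap.comp_apply, Submodule.subtype_apply, LinearMap.coe_restrict_apply, hfl,
      LinearMap.proj_apply, eY_sum]
    simp [hE]
  · intro j p q g
    apply Subtype.ext
    simp only [LinearMap.coe_restrict_apply, LinearMap.sub_apply, map_sub, hEc]
    simp
  · intro c d v; simp
  · intro p q c v
    apply Subtype.ext
    simp only [LinearMap.coe_restrict_apply, hfl, Submodule.coe_sub]
    funext k
    have h := hgl p q k c v
    rw [sub_eq_iff_eq_add] at h
    simp only [eY_apply, h, Pi.sub_apply]
    by_cases h1 : p = c <;> by_cases h2 : q = k <;> simp [h1, h2, eq_comm] <;>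
      simp_all [eq_comm] <;> abel
  · intro j p q c v
    apply Subtype.ext
    simp only [LinearMap.coe_restrict_apply, hfo _ (Fin.castSucc_lt_last j).ne]
    funext k
    simp only [cw_apply]
    exact hcl _ (Fin.castSucc_lt_last j).ne _ _ _ _ _
  · intro g hg
    apply Subtype.ext
    funext k
    simpa using hg k
  · intro c r v
    apply Subtype.ext
    funext k
    simp

lemma main_zero {N n : ℕ} {M : Type w} [AddCommGroup M] [Module ℂ M] {a : Fin N} {ρ : Fin N → ℂ}
    (ih : ∀ (M : Type w) [AddCommGroup M] [Module ℂ M] (z : Fin n → ℂ)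
      (e : Fin n → Fin N → Fin N → Module.End ℂ M) (_ : Chain e) (μ : Fin n → Fin N → ℕ) (v : M)
      (_ : ∀ j b, e j b b v = (μ j b : ℂ) • v), Sol a ρ z e (fun b => ∑ j, μ j b) v)
    (z : Fin (n + 1) → ℂ) (e : Fin (n + 1) → Fin N → Fin N → Module.End ℂ M) (hC : Chain e)
    (μ : Fin (n + 1) → Fin N → ℕ) (v : M) (hv : ∀ j b, e j b b v = (μ j b : ℂ) • v)
    (h0 : ∀ b, μ (Fin.last n) b = 0) : Sol a ρ z e (fun b => ∑ j, μ j b) v := by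
  set W : Submodule ℂ M := ⨅ p, ⨅ q, LinearMap.ker (e (Fin.last n) p q) with hW
  have hmem : ∀ y, y ∈ W ↔ ∀ p q, e (Fin.last n) p q y = 0 := by
    intro y; simp [hW, Submodule.mem_iInf]
  have hinv : ∀ (j : Fin n) p q, ∀ y ∈ W, e j.castSucc p q y ∈ W := by
    intro j p q y hy
    rw [hmem] at hy ⊢
    intro p' q'
    rw [hC.comm _ _ (Fin.castSucc_lt_last j).ne', hy, map_zero]
  have hvW : v ∈ W := by
    rw [hmem]
    intro p q
    obtain ⟨K, hK⟩ := hC.nn (Fin.last n) q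
    exact nn_kill (hC.gl _) hK (by rw [hv, h0]; simp) p
  set eW : Fin n → Fin N → Fin N → Module.End ℂ W :=
    fun j p q => (e j.castSucc p q).restrict (hinv j p q) with heW
  have hCW : Chain eW := by
    refine ⟨?_, ?_, ?_⟩
    · intro j p q c d g
      apply Subtype.ext
      have h := hC.gl j.castSucc p q c d g
      simp only [heW, Submodule.coe_sub, LinearMap.coe_restrict_apply]
      rw [h]
      congr 1 <;> split_ifs <;> simp
    · intro i j hij p q c d g
      apply Subtype.ext
      simp only [heW, LinearMap.coe_restrict_apply]
      exact hC.comm _ _ (by simpa using hij) _ _ _ _ _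
    · intro j b
      obtain ⟨K, hK⟩ := hC.nn j.castSucc b
      refine ⟨K, aeval_restrict_zero (f := e j.castSucc b b) (fun g => by simp [heW]) ?_⟩
      intro g; rw [hK]; rfl
  obtain ⟨φ, h1, h2, h3, h4⟩ := ih W (fun j => z j.castSucc) eW hCW (fun j => μ j.castSucc)
    ⟨v, hvW⟩ (fun j b => Subtype.ext (by simp [heW, hv]))
  have hm : ∀ b, ∑ j, μ j b = ∑ j : Fin n, μ j.castSucc b := by
    intro b; rw [Fin.sum_univ_castSucc, h0, add_zero]
  simp only [hm]
  refine ⟨fun α u => W.subtype (φ α u), ?_, fun α => PolyLT_map _ (h2 α), ?_, ?_⟩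
  · intro α b u hu
    have h := h1 α b u (fun j => hu _)
    simp only [h, map_sum, map_smul]
    refine Finset.sum_congr rfl fun c _ => ?_
    congr 1
    rw [TC_succ_apply]
    have hi := fun k g => TC_intertwine W.subtype (fun j => z j.castSucc)
      (fun j => e j.castSucc) eW (fun j p q g => by simp [heW]) u k b g
    simp only [hi, LL_apply]
    have hz : ∀ p q (g : W), e (Fin.last n) p q (W.subtype g) = 0 :=
      fun p q g => (hmem _).mp g.2 p q
    simp only [hz, smul_zero, add_zero, Finset.sum_ite_eq, Finset.mem_univ, if_true]
  · convert PolyLT_map W.subtype h3 using 1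
    funext u
    simp
  · intro α b u
    have h := congrArg W.subtype (h4 α b u)
    have hz : ∀ p q (g : W), e (Fin.last n) p q (W.subtype g) = 0 :=
      fun p q g => (hmem _).mp g.2 p q
    rw [map_smul] at h
    rw [← h, Fin.sum_univ_castSucc, LinearMap.add_apply, hz, add_zero]
    simp [heW, LinearMap.sum_apply]

theorem main_ind {N : ℕ} {a : Fin N} {ρ : Fin N → ℂ} (hρ : ρ a = 1)
    (hρ1 : ∀ k, k ≠ a → ρ k ≠ 1) (n : ℕ) :
    ∀ (M : Type w) [AddCommGroup M] [Module ℂ M] (z : Fin n → ℂ)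
      (e : Fin n → Fin N → Fin N → Module.End ℂ M) (_ : Chain e) (μ : Fin n → Fin N → ℕ) (v : M)
      (_ : ∀ j b, e j b b v = (μ j b : ℂ) • v), Sol a ρ z e (fun b => ∑ j, μ j b) v := by
  induction n with
  | zero =>
    intro M _ _ z e hC μ v hv
    refine ⟨fun α _ => if α = 0 then v else 0, ?_, ?_, ?_, ?_⟩
    · intro α b u _
      have h2 : ∀ c b (y : M), TC z e u c b y = if c = b then y else 0 :=
        fun c b y => TC_zero_apply z e u c b y
      simp only [h2, smul_ite, smul_zero]
      rw [Finset.sum_ite_eq']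
      simp only [Finset.mem_univ, if_true]
      by_cases hb : b = a
      · simp [hb, hρ]
      · have : up a α b ≠ 0 := by
          intro h
          have := congrFun h b
          simp [up, hb] at this
        simp [this]
    · intro α
      by_cases hα : α = 0
      · subst hα
        exact ⟨fun _ => v, fun u => by simp⟩
      · simp only [hα, if_false]; exact Submodule.zero_mem _
    · refine ⟨0, fun u => ?_⟩
      simp
    · intro α b u
      by_cases hα : α = 0
      · subst hα; simp
      · simp [hα]
  | succ n ih =>
    have key : ∀ (d : ℕ) (M : Type w) [AddCommGroup M] [Module ℂ M] (z : Fin (n + 1) → ℂ)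
      (e : Fin (n + 1) → Fin N → Fin N → Module.End ℂ M) (_ : Chain e)
      (μ : Fin (n + 1) → Fin N → ℕ) (v : M)
      (_ : ∀ j b, e j b b v = (μ j b : ℂ) • v) (_ : ∑ b, μ (Fin.last n) b = d),
      Sol a ρ z e (fun b => ∑ j, μ j b) v := by
      intro d
      induction d with
      | zero =>
        intro M _ _ z e hC μ v hv hd
        exact main_zero ih z e hC μ v hv (fun b => by
          simpa using (Finset.sum_eq_zero_iff.mp hd) b (Finset.mem_univ _))
      | succ d ihd =>
        intro M _ _ z e hC μ v hv hd
        obtain ⟨X, _, _, eX, x, Θ, pd, hCX, hR, p1, p2, p3, p4, p5⟩ := exists_X hC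
        have hvs : v = ((d + 1 : ℕ) : ℂ)⁻¹ • ∑ c, x c (pd c v) := by
          simp only [p1, hv, ← Finset.sum_smul]
          rw [← Nat.cast_sum, hd, smul_smul, inv_mul_cancel₀ (Nat.cast_ne_zero.mpr (by omega)),
            one_smul]
        rw [hvs]
        refine Sol_smul _ (Sol_sum _ _ fun c _ => ?_)
        by_cases hc : μ (Fin.last n) c = 0
        · have : x c (pd c v) = 0 := by rw [p1, hv, hc]; simp
          rw [this]; exact Sol_zero
        · set μ' : Fin (n + 1) → Fin N → ℕ :=
            fun j b => μ j b - if j = Fin.last n ∧ b = c then 1 else 0 with hμ'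
          have hμs : ∀ j b, μ j b = μ' j b + if j = Fin.last n ∧ b = c then 1 else 0 := by
            intro j b
            simp only [hμ']
            by_cases h : j = Fin.last n ∧ b = c
            · obtain ⟨rfl, rfl⟩ := h; simp; omega
            · simp [h]
          have hsum : (fun b => ∑ j, μ j b) = fun b => ∑ j, μ' j b + if b = c then 1 else 0 := by
            funext b
            rw [Finset.sum_congr rfl fun j _ => hμs j b, Finset.sum_add_distrib]
            by_cases hb : b = c <;> simp [hb]
          have hS : Sol a ρ z eX (fun b => ∑ j, μ' j b) (pd c v) := by
            refine ihd X z eX hCX μ' (pd c v) ?_ ?_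
            · intro j b
              refine Fin.lastCases ?_ (fun j => ?_) j
              · rw [p2, hv, p5, hμs (Fin.last n) b]
                by_cases hb : b = c
                · subst hb; simp; module
                · simp [hb]
              · rw [p3, hv, p5, hμs j.castSucc b]
                simp [(Fin.castSucc_lt_last j).ne]
            · have h1 : ∑ b, μ (Fin.last n) b = ∑ b, μ' (Fin.last n) b + 1 := by
                rw [Finset.sum_congr rfl fun b _ => hμs (Fin.last n) b, Finset.sum_add_distrib]
                simp
              omega
          rw [hsum]
          by_cases hca : c = a
          · subst hca
            exact step_self hR hCX.gl hCX.comm hρ hρ1 hS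
          · exact step_ne hR hρ hca hS
    intro M _ _ z e hC μ v hv
    exact key _ M z e hC μ v hv rfl

end XXXModel

namespace XXXModel

universe w

lemma lagr (K k : ℕ) (hk : k < K) : ∃ c : ℂ,
    (Polynomial.X - Polynomial.C (k : ℂ)) *
      Lagrange.basis (Finset.range K) (fun i : ℕ => (i : ℂ)) k = Polynomial.C c * nnp K := by
  refine ⟨∏ j ∈ (Finset.range K).erase k, ((k : ℂ) - j)⁻¹, ?_⟩
  unfold Lagrange.basis Lagrange.basisDivisor nnp
  rw [Finset.prod_mul_distrib, map_prod, ← Finset.mul_prod_erase (Finset.range K)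
    (fun i : ℕ => Polynomial.X - Polynomial.C (i : ℂ)) (Finset.mem_range.mpr hk)]
  ring

lemma eig_decomp {ι M : Type*} [AddCommGroup M] [Module ℂ M] (f : ι → Module.End ℂ M)
    (hf : ∀ i j v, f i (f j v) = f j (f i v)) (hn : ∀ i, ∃ K, Polynomial.aeval (f i) (nnp K) = 0)
    (W : Submodule ℂ M) (hW : ∀ i, ∀ v ∈ W, f i v ∈ W) (s : Finset ι) :
    ∀ v ∈ W, v ∈ Submodule.span ℂ {y | y ∈ W ∧ ∀ i ∈ s, ∃ k : ℕ, f i y = (k : ℂ) • y} := by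
  classical
  induction s using Finset.induction_on with
  | empty => intro v hv; exact Submodule.subset_span ⟨hv, by simp⟩
  | insert i s hi ih =>
    intro v hv
    refine (Submodule.span_le.mpr ?_) (ih v hv)
    rintro y ⟨hy, hys⟩
    obtain ⟨K, hK⟩ := hn i
    by_cases hK0 : K = 0
    · subst hK0
      have : y = 0 := by simpa [nnp] using LinearMap.congr_fun hK y
      rw [this]; exact Submodule.zero_mem _
    have hone := Lagrange.sum_basis (s := Finset.range K) (v := fun i : ℕ => (i : ℂ))
      (fun a _ b _ h => Nat.cast_injective h) ⟨0, Finset.mem_range.mpr (by omega)⟩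
    have h2 := congrArg (fun p => Polynomial.aeval (f i) p y) hone
    simp only [map_sum, LinearMap.sum_apply, map_one, Module.End.one_apply] at h2
    rw [← h2]
    refine Submodule.sum_mem _ fun k hk => Submodule.subset_span ⟨?_, ?_⟩
    · generalize Lagrange.basis (Finset.range K) (fun i : ℕ => (i : ℂ)) k = p
      induction p using Polynomial.induction_on' with
      | add p q hp hq => rw [map_add]; exact Submodule.add_mem _ hp hq
      | monomial d r =>
        rw [Polynomial.aeval_monomial]
        refine Submodule.smul_mem _ r ?_
        induction d with
        | zero => simpa using hy
        | succ d ihd => rw [pow_succ']; exact hW i _ ihd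
    · intro j hj
      rcases Finset.mem_insert.mp hj with rfl | hj
      · refine ⟨k, ?_⟩
        obtain ⟨c, hc⟩ := lagr K k (Finset.mem_range.mp hk)
        have h3 := congrArg (fun p => Polynomial.aeval (f j) p y) hc
        simp only [map_mul, hK, mul_zero, LinearMap.zero_apply, map_sub, Polynomial.aeval_X,
          Polynomial.aeval_C, Module.End.mul_apply, LinearMap.sub_apply,
          Module.algebraMap_end_apply] at h3
        exact sub_eq_zero.mp h3
      · obtain ⟨k', hk'⟩ := hys j hj
        refine ⟨k', ?_⟩
        have := aeval_intertwine (f j) (f i) (f i) (fun g => hf i j g)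
          (Lagrange.basis (Finset.range K) (fun i : ℕ => (i : ℂ)) k) y
        rw [← this, hk', map_smul]

theorem Sol_weight {N n : ℕ} {a : Fin N} {ρ : Fin N → ℂ} (hρ : ρ a = 1)
    (hρ1 : ∀ k, k ≠ a → ρ k ≠ 1) (M : Type w) [AddCommGroup M] [Module ℂ M] (z : Fin n → ℂ)
      (e : Fin n → Fin N → Fin N → Module.End ℂ M) (hC : Chain e) (m : Fin N → ℕ) (v : M)
      (hv : ∀ b, (∑ j, e j b b) v = (m b : ℂ) • v) : Sol a ρ z e m v := by
  have hcd : ∀ i j b c v, e i b b (e j c c v) = e j c c (e i b b v) := by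
    intro i j b c v
    by_cases hij : i = j
    · subst hij
      have := hC.gl i b b c c v
      rw [sub_eq_iff_eq_add] at this
      rw [this]
      by_cases h : b = c
      · subst h; simp
      · simp [h, Ne.symm h]
    · exact hC.comm i j hij _ _ _ _ _
  have := eig_decomp (fun p : Fin n × Fin N => e p.1 p.2 p.2) (fun i j v => hcd _ _ _ _ _)
    (fun i => hC.nn _ _)
    (⨅ b, LinearMap.ker ((∑ j, e j b b) - (m b : ℂ) • (1 : Module.End ℂ M)))
    (by
      intro i v hv
      simp only [Submodule.mem_iInf, LinearMap.mem_ker, LinearMap.sub_apply, LinearMap.smul_apply,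
        Module.End.one_apply, sub_eq_zero, LinearMap.sum_apply] at hv ⊢
      intro b
      rw [← map_smul, ← hv b, map_sum]
      exact Finset.sum_congr rfl fun j _ => hcd _ _ _ _ _) Finset.univ v (by
      simp only [Submodule.mem_iInf, LinearMap.mem_ker, LinearMap.sub_apply, LinearMap.smul_apply,
        Module.End.one_apply, sub_eq_zero]
      exact hv)
  clear hv
  induction this using Submodule.span_induction with
  | mem y hy =>
    obtain ⟨hy1, hy2⟩ := hy
    by_cases h0 : y = 0
    · rw [h0]; exact Sol_zero
    choose μ hμ using fun (j : Fin n) (b : Fin N) => hy2 (j, b) (Finset.mem_univ _)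
    have hm : m = fun b => ∑ j, μ j b := by
      funext b
      simp only [Submodule.mem_iInf, LinearMap.mem_ker, LinearMap.sub_apply, LinearMap.smul_apply,
        Module.End.one_apply, sub_eq_zero, LinearMap.sum_apply] at hy1
      have h := hy1 b
      have h' : ∑ j, e j b b y = ((∑ j, μ j b : ℕ) : ℂ) • y := by
        push_cast
        rw [Finset.sum_smul]
        exact Finset.sum_congr rfl fun j _ => hμ j b
      rw [h', ← sub_eq_zero, ← sub_smul, smul_eq_zero] at h
      rcases h with h | h
      · exact_mod_cast (sub_eq_zero.mp h).symm
      · exact absurd h h0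
    rw [hm]
    exact main_ind hρ hρ1 n M z e hC μ y hμ
  | zero => exact Sol_zero
  | add x y _ _ hx hy => exact Sol_add hx hy
  | smul r x _ hx => exact Sol_smul r hx

end XXXModel

namespace XXXModel

set_option linter.unusedSectionVars false
set_option linter.unusedDecidableInType false
section Man
variable {R : Type*} [Ring R] [Module ℂ R] {N : ℕ}

/-- Manin-type relation for a pair of matrices. -/
def Man (A B : Fin N → Fin N → R) : Prop :=
  ∀ a c b d, A a b * B c d + A c b * B a d = A a d * B c b + A c d * B a b

lemma Man_mul {A B A' B' : Matrix (Fin N) (Fin N) R} (h : Man A B) (h' : Man A' B')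
    (hc : ∀ a b c d, Commute (B a b) (A' c d)) : Man (A * A') (B * B') := by
  have key : ∀ a c b d, (A * A') a b * (B * B') c d =
      ∑ x, ∑ y, A a x * B c y * (A' x b * B' y d) := by
    intro a c b d
    rw [Matrix.mul_apply, Matrix.mul_apply, Finset.sum_mul_sum]
    refine Finset.sum_congr rfl fun x _ => Finset.sum_congr rfl fun y _ => ?_
    rw [mul_assoc, ← mul_assoc (A' x b), ← (hc c y x b).eq]
    simp only [mul_assoc]
  intro a c b d
  simp only [key, ← Finset.sum_add_distrib, ← add_mul]
  have sw : ∀ b d, ∑ x, ∑ y, (A a x * B c y + A c x * B a y) * (A' x b * B' y d) =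
      ∑ x, ∑ y, (A a x * B c y + A c x * B a y) * (A' y b * B' x d) := by
    intro b d
    rw [Finset.sum_comm]
    refine Finset.sum_congr rfl fun x _ => Finset.sum_congr rfl fun y _ => ?_
    rw [h a c y x]
  have dbl : ∀ b d, (2 : ℂ) • ∑ x, ∑ y, (A a x * B c y + A c x * B a y) * (A' x b * B' y d) =
      ∑ x, ∑ y, (A a x * B c y + A c x * B a y) * (A' x b * B' y d + A' y b * B' x d) := by
    intro b d
    rw [two_smul]
    nth_rw 2 [sw]
    simp only [← Finset.sum_add_distrib, ← mul_add]
  have : (2 : ℂ) • ∑ x, ∑ y, (A a x * B c y + A c x * B a y) * (A' x b * B' y d) =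
      (2 : ℂ) • ∑ x, ∑ y, (A a x * B c y + A c x * B a y) * (A' x d * B' y b) := by
    rw [dbl, dbl]
    refine Finset.sum_congr rfl fun x _ => Finset.sum_congr rfl fun y _ => ?_
    rw [h' x y b d]
  exact smul_right_injective R (two_ne_zero (α := ℂ)) this

lemma split_list {f : Fin N → R} (i : ℕ) (hi : i + 1 < N) :
    (List.ofFn f).prod = ((List.ofFn f).take i).prod *
      ((f ⟨i, by omega⟩ * f ⟨i + 1, hi⟩) * ((List.ofFn f).drop (i + 2)).prod) := by
  conv_lhs => rw [← List.take_append_drop i (List.ofFn f)]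
  rw [List.prod_append, List.drop_eq_getElem_cons (by simp; omega),
    List.drop_eq_getElem_cons (by simp; omega)]
  simp [mul_assoc]

lemma take_congr {f g : Fin N → R} (i : ℕ) (h : ∀ j : Fin N, j.1 < i → f j = g j) :
    (List.ofFn f).take i = (List.ofFn g).take i := by
  apply List.ext_getElem (by simp)
  intro k h1 h2
  simp at h1
  simp only [List.getElem_take, List.getElem_ofFn]
  exact h _ (by simp; omega)

lemma drop_congr {f g : Fin N → R} (i : ℕ) (h : ∀ j : Fin N, i ≤ j.1 → f j = g j) :
    (List.ofFn f).drop i = (List.ofFn g).drop i := by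
  apply List.ext_getElem (by simp)
  intro k h1 h2
  simp only [List.getElem_drop, List.getElem_ofFn]
  exact h _ (by simp)

/-- Row determinant with rows `r`. -/
def rdet (X : Fin N → Fin N → R) (r : Fin N → Fin N) : R :=
  ∑ σ : Equiv.Perm (Fin N), ((Equiv.Perm.sign σ : ℤˣ) : ℤ) •
    (List.ofFn fun i => X (r i) (σ i)).prod

lemma eq_neg_zero {x : R} (h : x = -x) : x = 0 := by
  have : (2 : ℂ) • x = (2 : ℂ) • (0 : R) := by
    rw [two_smul, smul_zero]; nth_rw 1 [h]; simp
  exact smul_right_injective R (two_ne_zero (α := ℂ)) this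

lemma rdet_adj {X : Fin N → Fin N → R} (hX : Man X X) (r : Fin N → Fin N) (i : ℕ)
    (hi : i + 1 < N) :
    rdet X (r ∘ Equiv.swap ⟨i, by omega⟩ ⟨i + 1, hi⟩) = - rdet X r := by
  set s : Equiv.Perm (Fin N) := Equiv.swap ⟨i, by omega⟩ ⟨i + 1, hi⟩ with hs
  have hsgn : Equiv.Perm.sign s = -1 := Equiv.Perm.sign_swap (by simp)
  rw [eq_neg_iff_add_eq_zero]
  apply eq_neg_zero
  have si : s ⟨i, by omega⟩ = ⟨i + 1, hi⟩ := Equiv.swap_apply_left _ _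
  have si1 : s ⟨i + 1, hi⟩ = ⟨i, by omega⟩ := Equiv.swap_apply_right _ _
  have so : ∀ j : Fin N, j.1 ≠ i → j.1 ≠ i + 1 → s j = j := fun j h1 h2 =>
    Equiv.swap_apply_of_ne_of_ne (by simpa [Fin.ext_iff] using h1) (by simpa [Fin.ext_iff] using h2)
  have pt : ∀ σ : Equiv.Perm (Fin N), (List.ofFn fun i => X ((r ∘ s) i) (σ i)).prod +
      (List.ofFn fun i => X (r i) (σ i)).prod =
      (List.ofFn fun i => X ((r ∘ s) i) ((σ * s) i)).prod +
      (List.ofFn fun i => X (r i) ((σ * s) i)).prod := by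
    intro σ
    rw [split_list i hi, split_list (f := fun i => X (r i) (σ i)) i hi,
      split_list (f := fun i => X ((r ∘ s) i) ((σ * s) i)) i hi,
      split_list (f := fun i => X (r i) ((σ * s) i)) i hi]
    have t1 := take_congr (f := fun i => X ((r ∘ s) i) (σ i)) (g := fun i => X (r i) (σ i)) i
      (fun j hj => by simp [so j (by omega) (by omega)])
    have t2 := take_congr (f := fun i => X ((r ∘ s) i) ((σ * s) i)) (g := fun i => X (r i) (σ i)) i
      (fun j hj => by simp [so j (by omega) (by omega)])
    have t3 := take_congr (f := fun i => X (r i) ((σ * s) i)) (g := fun i => X (r i) (σ i)) i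
      (fun j hj => by simp [so j (by omega) (by omega)])
    have d1 := drop_congr (f := fun i => X ((r ∘ s) i) (σ i)) (g := fun i => X (r i) (σ i)) (i + 2)
      (fun j hj => by simp [so j (by omega) (by omega)])
    have d2 := drop_congr (f := fun i => X ((r ∘ s) i) ((σ * s) i)) (g := fun i => X (r i) (σ i))
      (i + 2) (fun j hj => by simp [so j (by omega) (by omega)])
    have d3 := drop_congr (f := fun i => X (r i) ((σ * s) i)) (g := fun i => X (r i) (σ i)) (i + 2)
      (fun j hj => by simp [so j (by omega) (by omega)])
    rw [t1, t2, t3, d1, d2, d3, ← mul_add, ← mul_add, ← add_mul, ← add_mul]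
    congr 2
    simp only [Function.comp, Equiv.Perm.mul_apply, si, si1]
    rw [hX (r ⟨i + 1, hi⟩)]
  unfold rdet
  rw [← Finset.sum_add_distrib, ← Finset.sum_neg_distrib, ← Equiv.sum_comp (Equiv.mulRight s)]
  refine Finset.sum_congr rfl fun σ _ => ?_
  rw [← smul_add, ← smul_add, ← smul_neg, Equiv.coe_mulRight, ← pt, Equiv.Perm.sign_mul, hsgn]
  simp
  abel

lemma rdet_perm {K : ℕ} {X : Fin (K + 1) → Fin (K + 1) → R} (hX : Man X X)
    (π : Equiv.Perm (Fin (K + 1))) : ∀ (r : Fin (K + 1) → Fin (K + 1)),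
    rdet X (r ∘ π) = ((Equiv.Perm.sign π : ℤˣ) : ℤ) • rdet X r := by
  have hm : π ∈ Submonoid.closure
      (Set.range fun i : Fin K ↦ Equiv.swap i.castSucc i.succ) := by
    rw [Equiv.Perm.mclosure_swap_castSucc_succ]; trivial
  induction hm using Submonoid.closure_induction with
  | mem x hx =>
    intro r
    obtain ⟨i, rfl⟩ := hx
    have := rdet_adj hX r i.1 (by omega)
    have hs : Equiv.Perm.sign (Equiv.swap i.castSucc i.succ) = -1 :=
      Equiv.Perm.sign_swap (by simp [Fin.ext_iff])
    simp only [hs]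
    rw [Units.val_neg, Units.val_one, neg_smul, one_smul]
    exact this
  | one => intro r; simp
  | mul x y _ _ hx hy =>
    intro r
    have : r ∘ (x * y : Equiv.Perm _) = (r ∘ x) ∘ y := by funext j; simp
    rw [this, hy, hx, Equiv.Perm.sign_mul, smul_smul, mul_comm]
    simp

lemma rdet_rep {K : ℕ} {X : Fin (K + 1) → Fin (K + 1) → R} (hX : Man X X)
    (r : Fin (K + 1) → Fin (K + 1)) (i j : Fin (K + 1)) (hij : i ≠ j) (h : r i = r j) :
    rdet X r = 0 := by
  have := rdet_perm hX (Equiv.swap i j) r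
  have h2 : r ∘ Equiv.swap i j = r := by
    funext k
    simp only [Function.comp]
    by_cases h1 : k = i
    · subst h1; simp [h]
    by_cases h2 : k = j
    · subst h2; simp [h]
    rw [Equiv.swap_apply_of_ne_of_ne h1 h2]
  rw [h2, Equiv.Perm.sign_swap hij] at this
  apply eq_neg_zero
  simpa using this

end Man
end XXXModel

namespace XXXModel

section Xs
variable {N : ℕ} {M : Type*} [AddCommGroup M] [Module ℂ M]

lemma LL_Man (z : ℂ) (e : Fin N → Fin N → Module.End ℂ M) (he : Gl e) (u : ℂ)
    (h1 : u ≠ z) (h2 : u - 1 ≠ z) : Man (LL z e u) (LL z e (u - 1)) := by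
  intro a c b d
  have hw : (u - 1 - z)⁻¹ - (u - z)⁻¹ = (u - z)⁻¹ * (u - 1 - z)⁻¹ := by
    have := sub_ne_zero.mpr h1
    have := sub_ne_zero.mpr h2
    field_simp
    ring
  apply LinearMap.ext; intro v
  have k1 : ((u - z)⁻¹ * (u - 1 - z)⁻¹) • _ = ((u - 1 - z)⁻¹ - (u - z)⁻¹) • _ :=
    congrArg₂ (fun (c : ℂ) x => c • x) hw.symm (he b a d c v)
  have k2 : ((u - z)⁻¹ * (u - 1 - z)⁻¹) • _ = ((u - 1 - z)⁻¹ - (u - z)⁻¹) • _ :=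
    congrArg₂ (fun (c : ℂ) x => c • x) hw.symm (he b c d a v)
  clear hw
  rw [LinearMap.add_apply, LinearMap.add_apply]
  simp only [Module.End.mul_apply, LL_apply, map_add, map_smul]
  have r : ∀ (f : Module.End ℂ M) (p : Prop) [Decidable p] (x : M),
    f (if p then x else 0) = if p then f x else 0 := by
    intro f p _ x; split_ifs <;> simp
  simp only [r]
  generalize (u - 1 - z)⁻¹ = w' at *
  generalize (u - z)⁻¹ = w at *
  rcases Classical.propComplete (a = b) with h1 | h1 <;>
    rcases Classical.propComplete (c = d) with h2 | h2 <;>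
    rcases Classical.propComplete (c = b) with h3 | h3 <;>
    rcases Classical.propComplete (a = d) with h4 | h4 <;>
    simp only [ite_true, ite_false, h1, h2, h3, h4, smul_zero] at k1 k2 ⊢ <;>
    linear_combination (norm := module) k1 + k2

lemma TC_Man : ∀ {n : ℕ} (z : Fin n → ℂ) (e : Fin n → Fin N → Fin N → Module.End ℂ M)
    (_ : ∀ j, Gl (e j))
    (_ : ∀ i j, i ≠ j → ∀ a b c d v, e i a b (e j c d v) = e j c d (e i a b v)) (u : ℂ)
    (_ : ∀ j, u ≠ z j) (_ : ∀ j, u - 1 ≠ z j), Man (TC z e u) (TC z e (u - 1))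
  | 0, z, e, he, hc, u, h1, h2 => by
    intro a c b d
    unfold TC
    simp only [Matrix.one_apply]
    by_cases h1 : a = b <;> by_cases h2 : c = d <;> by_cases h3 : c = b <;> by_cases h4 : a = d <;>
      simp_all
  | n + 1, z, e, he, hc, u, h1, h2 => by
    unfold TC
    refine Man_mul (LL_Man _ _ (he _) u (h1 _) (h2 _))
      (TC_Man _ _ (fun j => he _) (fun i j hij => hc _ _ (by simpa using hij)) u
        (fun j => h1 _) (fun j => h2 _)) ?_
    intro a b c d
    ext v
    simp only [Module.End.mul_apply]
    refine (TC_intertwine (LL (z (Fin.last n)) (e (Fin.last n)) (u - 1) a b) _ _ _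
      (fun j a' b' g => ?_) u c d v).symm
    simp only [LL_apply, map_add, map_smul]
    rw [hc _ _ (Fin.castSucc_lt_last j).ne]
    split_ifs <;> simp

/-- The operators `X_{ab}` on sequences. -/
def Xs (Q : Fin N → ℂ) (T : ℕ → Fin N → Fin N → Module.End ℂ M) (a b : Fin N) :
    Module.End ℂ (ℕ → M) :=
  LinearMap.pi fun k => (if a = b then LinearMap.proj k else 0) -
    Q a • (T k a b ∘ₗ LinearMap.proj (k + 1))

lemma Xs_apply (Q : Fin N → ℂ) (T : ℕ → Fin N → Fin N → Module.End ℂ M) (a b : Fin N)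
    (g : ℕ → M) (k : ℕ) :
    Xs Q T a b g k = (if a = b then g k else 0) - Q a • T k a b (g (k + 1)) := by
  unfold Xs
  split_ifs <;> simp

lemma Xs_Man (Q : Fin N → ℂ) (T : ℕ → Fin N → Fin N → Module.End ℂ M)
    (hT : ∀ k, Man (T k) (T (k + 1))) : Man (Xs Q T) (Xs Q T) := by
  intro a c b d
  apply LinearMap.ext; intro g
  funext k
  have h := congrArg (fun f : Module.End ℂ M => f (g (k + 2))) (hT k a c b d)
  simp only [LinearMap.add_apply, Module.End.mul_apply] at h
  simp only [LinearMap.add_apply, Module.End.mul_apply, Pi.add_apply, Xs_apply, map_sub, map_smul,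
    smul_sub, smul_smul, add_assoc]
  have h' := congrArg (fun x => (Q a * Q c) • x) h
  simp only [smul_add] at h'
  have r : ∀ (f : Module.End ℂ M) (p : Prop) [Decidable p] (x : M),
    f (if p then x else 0) = if p then f x else 0 := by
    intro f p _ x; split_ifs <;> simp
  simp only [r, one_add_one_eq_two, mul_comm (Q c) (Q a)]
  rcases Classical.propComplete (a = b) with h1 | h1 <;>
    rcases Classical.propComplete (c = d) with h2 | h2 <;>
    rcases Classical.propComplete (c = b) with h3 | h3 <;>
    rcases Classical.propComplete (a = d) with h4 | h4 <;>
    simp only [ite_true, ite_false, h1, h2, h3, h4, smul_zero] at h' ⊢ <;>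
    linear_combination (norm := module) h'

lemma list_vanish (l : List (Module.End ℂ (ℕ → M)))
    (hl : ∀ x ∈ l, ∀ g : ℕ → M, ∀ p, (∀ k < p + 1, g k = 0) → ∀ k < p, x g k = 0) :
    ∀ (g : ℕ → M) (p : ℕ), (∀ k < p + l.length, g k = 0) → ∀ k < p, l.prod g k = 0 := by
  induction l with
  | nil => intro g p h k hk; simpa using h k (by simpa using hk)
  | cons x l ih =>
    intro g p h k hk
    rw [List.prod_cons, Module.End.mul_apply]
    exact hl x (by simp) _ p (ih (fun y hy => hl y (by simp [hy])) g (p + 1)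
      (fun k hk => h k (by simp at hk ⊢; omega))) k hk

lemma Xs_vanish (Q : Fin N → ℂ) (T : ℕ → Fin N → Fin N → Module.End ℂ M) (a b : Fin N)
    (g : ℕ → M) (p : ℕ) (h : ∀ k < p + 1, g k = 0) : ∀ k < p, Xs Q T a b g k = 0 := by
  intro k hk
  rw [Xs_apply, h k (by omega), h (k + 1) (by omega)]
  simp

/-- The determinant kills a solution of the system. -/
lemma rdet_kill {K : ℕ} (Q : Fin (K + 1) → ℂ)
    (T : ℕ → Fin (K + 1) → Fin (K + 1) → Module.End ℂ M)
    (hT : ∀ k, Man (T k) (T (k + 1))) (f : Fin (K + 1) → ℕ → M)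
    (hf : ∀ b, ∀ k < K + 1, f b k = ∑ c, Q c • T k c b (f c (k + 1))) (a : Fin (K + 1)) :
    rdet (Xs Q T) id (f a) 0 = 0 := by
  have hX := Xs_Man Q T hT
  set π : Equiv.Perm (Fin (K + 1)) := Equiv.swap a (Fin.last K) with hπ
  have h1 := rdet_perm hX π id
  have h2 : rdet (Xs Q T) (⇑π) (f a) =
      ∑ c, rdet (Xs Q T) (Function.update π (Fin.last K) c) (f c) := by
    rw [Finset.sum_eq_single a]
    · congr 2
      funext j
      by_cases hj : j = Fin.last K
      · subst hj; simp [hπ]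
      · simp [hj]
    · intro c _ hc
      have : π c ≠ Fin.last K := by
        intro h
        apply hc
        have := congrArg π h
        simpa [hπ] using this
      rw [rdet_rep hX _ (π c) (Fin.last K) this]
      · simp
      · rw [Function.update_self, Function.update_of_ne this]; simp [hπ]
    · simp
  have h3 : (∑ c, rdet (Xs Q T) (Function.update π (Fin.last K) c) (f c)) 0 = 0 := by
    have h4 : ∀ c, rdet (Xs Q T) (Function.update π (Fin.last K) c) (f c) =
        ∑ σ : Equiv.Perm (Fin (K + 1)), ((Equiv.Perm.sign σ : ℤˣ) : ℤ) •
          (List.ofFn fun i : Fin K => Xs Q T (π i.castSucc) (σ i.castSucc)).prod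
            (Xs Q T c (σ (Fin.last K)) (f c)) := by
      intro c
      unfold rdet
      rw [LinearMap.sum_apply]
      refine Finset.sum_congr rfl fun σ _ => ?_
      rw [LinearMap.smul_apply, List.ofFn_succ', List.prod_concat]
      simp
    simp only [h4]
    rw [Finset.sum_comm]
    rw [Finset.sum_apply]
    refine Finset.sum_eq_zero fun σ _ => ?_
    rw [← Finset.smul_sum, ← map_sum, Pi.smul_apply]
    rw [list_vanish _ ?_ _ 1 ?_ 0 (by omega), smul_zero]
    · intro x hx g p h
      rw [List.mem_ofFn] at hx
      obtain ⟨i, rfl⟩ := hx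
      exact Xs_vanish Q T _ _ g p h
    · intro k hk
      rw [List.length_ofFn] at hk
      simp only [Finset.sum_apply, Xs_apply, Finset.sum_sub_distrib, Finset.sum_ite_eq',
        Finset.mem_univ, if_true]
      rw [← hf _ k (by omega), sub_self]
  rw [← h2] at h3
  rw [Function.id_comp] at h1
  rw [h1, LinearMap.smul_apply, Pi.smul_apply] at h3
  rcases Int.units_eq_one_or (Equiv.Perm.sign π) with h | h <;> rw [h] at h3 <;> simpa using h3

end Xs
end XXXModel

namespace XXXModel

lemma TC_list {N : ℕ} {M : Type*} [AddCommGroup M] [Module ℂ M] : ∀ {n : ℕ} (z : Fin n → ℂ)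
    (e : Fin n → Fin N → Fin N → Module.End ℂ M) (u : ℂ),
    (List.ofFn fun j => LL (z j) (e j) u).reverse.prod = TC z e u
  | 0, z, e, u => by simp [TC]
  | n + 1, z, e, u => by
    rw [List.ofFn_succ', List.concat_eq_append, List.reverse_append, List.reverse_singleton,
      List.singleton_append, List.prod_cons, TC_list (fun j => z j.castSucc)]
    rfl

section D
variable {N n : ℕ} (V : Fin n → Type*) [∀ i, AddCommGroup (V i)] [∀ i, Module ℂ (V i)]
  (M : Type*) [AddCommGroup M] [Module ℂ M]
  (E : ∀ i : Fin n, Fin N → Fin N → (V i →ₗ[ℂ] V i))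
  (φ : M ≃ₗ[ℂ] PiTensorProduct ℂ V) (z : Fin n → ℂ) (Q : Fin N → ℂ)

lemma Tmat_eq (u : ℂ) : Tmat V M E φ z u = TC z (EE V M E φ) u := TC_list z (EE V M E φ) u

lemma Xop_eq (a b : Fin N) (f : ℂ → M) (u : ℂ) :
    Xop V M E φ z (Matrix.diagonal Q) a b f u =
      (if a = b then f u else 0) - Q a • TC z (EE V M E φ) u a b (f (u - 1)) := by
  unfold Xop
  rw [Tmat_eq, Finset.sum_eq_single a]
  · simp
  · intro c _ hc
    rw [Matrix.diagonal_apply_ne _ hc.symm, zero_smul]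
  · simp

/-- Truncated sequence of monodromy matrices. -/
def Ts (u : ℂ) (k : ℕ) : Fin N → Fin N → Module.End ℂ M :=
  fun a b => if k < N then TC z (EE V M E φ) (u - k) a b else 0

lemma fold_eq (u : ℂ) (f : ℂ → M) (l : List (Fin N × Fin N)) : ∀ k : ℕ, k + l.length ≤ N →
    (l.map fun p => Xop V M E φ z (Matrix.diagonal Q) p.1 p.2).foldr (· ∘ ·) id f (u - k) =
    (l.map fun p => Xs Q (Ts V M E φ z u) p.1 p.2).prod (fun k : ℕ => f (u - k)) k := by
  induction l with
  | nil => intro k _; simp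
  | cons p l ih =>
    intro k hk
    rw [List.length_cons] at hk
    rw [List.map_cons, List.foldr_cons, List.map_cons, List.prod_cons, Module.End.mul_apply,
      Xs_apply, Function.comp_apply, Xop_eq, ih k (by omega)]
    have := ih (k + 1) (by omega)
    push_cast at this
    rw [← this, ← sub_sub]
    unfold Ts
    rw [if_pos (show k < N by omega)]

lemma Dop_eq (u : ℂ) (f : ℂ → M) : Dop V M E φ z (Matrix.diagonal Q) f u =
    rdet (Xs Q (Ts V M E φ z u)) id (fun k : ℕ => f (u - k)) 0 := by
  unfold Dop rdet
  rw [LinearMap.sum_apply, Finset.sum_apply]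
  refine Finset.sum_congr rfl fun σ _ => ?_
  rw [LinearMap.smul_apply, Pi.smul_apply]
  congr 1
  have := fold_eq V M E φ z Q u f (List.ofFn fun a => (a, σ a)) 0 (by simp)
  simp only [Nat.cast_zero, sub_zero, List.map_ofFn] at this
  exact this

lemma Dop_kill (hN : 0 < N) (hC : Chain (EE V M E φ)) (u : ℂ) (hu : Good N z u)
    (f : Fin N → ℂ → M)
    (hf : ∀ b x, (∀ j, x ≠ z j) → f b x = ∑ c, Q c • TC z (EE V M E φ) x c b (f c (x - 1)))
    (a : Fin N) : Dop V M E φ z (Matrix.diagonal Q) (f a) u = 0 := by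
  obtain ⟨K, rfl⟩ : ∃ K, N = K + 1 := ⟨N - 1, by omega⟩
  rw [Dop_eq]
  refine rdet_kill Q (Ts V M E φ z u) ?_ (fun b (k : ℕ) => f b (u - k)) ?_ a
  · intro k
    by_cases hk : k + 1 < K + 1
    · have e1 : Ts V M E φ z u k = TC z (EE V M E φ) (u - k) := by
        unfold Ts; funext a b; rw [if_pos (by omega)]
      have e2 : Ts V M E φ z u (k + 1) = TC z (EE V M E φ) (u - k - 1) := by
        unfold Ts; funext a b; rw [if_pos hk]; push_cast; rw [sub_sub]
      rw [e1, e2]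
      refine TC_Man z _ hC.gl hC.comm _ (fun j => hu j k (by omega)) (fun j => ?_)
      have := hu j (k + 1) hk
      push_cast at this
      rwa [sub_sub]
    · have e2 : Ts V M E φ z u (k + 1) = 0 := by
        unfold Ts; funext a b; rw [if_neg hk]; rfl
      intro a c b d
      rw [e2]
      simp
  · intro b k hk
    rw [hf b (u - k) (fun j => hu j k hk)]
    refine Finset.sum_congr rfl fun c _ => ?_
    unfold Ts
    rw [if_pos hk]
    push_cast
    rw [sub_sub]

lemma Dop_Sol (hN : 0 < N) (hC : Chain (EE V M E φ)) (u : ℂ) (hu : Good N z u) (a : Fin N)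
    (q : ℂ) (hq : Complex.exp q = Q a) (ψ : (Fin N → ℕ) → ℂ → M)
    (hψ : Sys a (fun c => Q c / Q a) (fun u => ∀ j, u ≠ z j) (TC z (EE V M E φ)) ψ) :
    Dop V M E φ z (Matrix.diagonal Q) (fun x => Complex.exp (q * x) • ψ 0 x) u = 0 := by
  have h := Dop_kill V M E φ z Q hN hC u hu (fun c x => Complex.exp (q * x) • ψ (up a 0 c) x) ?_ a
  · simp only [up_self] at h; exact h
  · intro b x hx
    rw [hψ 0 b x hx, Finset.smul_sum]
    refine Finset.sum_congr rfl fun c _ => ?_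
    rw [map_smul, smul_smul, smul_smul]
    congr 1
    rw [mul_sub, mul_one, Complex.exp_sub, hq]
    ring

end D
end XXXModel

namespace XXXModel

section HW
variable {N : ℕ} {V : Type*} [AddCommGroup V] [Module ℂ V]

/-- Vectors obtained from `v` by lowering operators. -/
inductive Word (e : Fin N → Fin N → Module.End ℂ V) (v : V) : V → Prop
  | base : Word e v v
  | step (c d : Fin N) (x : V) (h : d < c) (hx : Word e v x) : Word e v (e c d x)

variable {e : Fin N → Fin N → Module.End ℂ V} {v : V}

lemma Word_span (he : Gl e) (h1 : ∀ a b : Fin N, a < b → e a b v = 0) (Λ : Fin N → ℂ)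
    (h2 : ∀ a, e a a v = Λ a • v)
    (h3 : ∀ W : Submodule ℂ V, (∀ a b : Fin N, ∀ x ∈ W, e a b x ∈ W) → v ∈ W → ∀ x, x ∈ W) :
    Submodule.span ℂ {x | Word e v x} = ⊤ := by
  have low : ∀ c d : Fin N, d < c → ∀ x ∈ Submodule.span ℂ {x | Word e v x},
      e c d x ∈ Submodule.span ℂ {x | Word e v x} := by
    intro c d hcd x hx
    induction hx using Submodule.span_induction with
    | mem y hy => exact Submodule.subset_span (Word.step c d y hcd hy)
    | zero => simp
    | add x y _ _ hx hy => rw [map_add]; exact Submodule.add_mem _ hx hy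
    | smul r x _ hx => rw [map_smul]; exact Submodule.smul_mem _ _ hx
  have all : ∀ x, Word e v x → ∀ a b, e a b x ∈ Submodule.span ℂ {x | Word e v x} := by
    intro x hx
    induction hx with
    | base =>
      intro a b
      rcases lt_trichotomy a b with h | h | h
      · rw [h1 a b h]; simp
      · subst h; rw [h2]; exact Submodule.smul_mem _ _ (Submodule.subset_span Word.base)
      · exact Submodule.subset_span (Word.step a b v h Word.base)
    | step c d x h hx ih =>
      intro a b
      have := he a b c d x
      rw [sub_eq_iff_eq_add] at this
      rw [this]
      refine Submodule.add_mem _ (Submodule.sub_mem _ ?_ ?_) (low c d h _ (ih a b))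
      · split_ifs
        · exact ih _ _
        · simp
      · split_ifs
        · exact ih _ _
        · simp
  rw [eq_top_iff]
  intro x _
  refine h3 _ ?_ (Submodule.subset_span Word.base) x
  intro a b x hx
  induction hx using Submodule.span_induction with
  | mem y hy => exact all y hy a b
  | zero => simp
  | add x y _ _ hx hy => rw [map_add]; exact Submodule.add_mem _ hx hy
  | smul r x _ hx => rw [map_smul]; exact Submodule.smul_mem _ _ hx

lemma Word_weight (he : Gl e) (Λ : Fin N → ℂ) (h2 : ∀ a, e a a v = Λ a • v) (l : Fin N)
    (hl : ∀ c, c ≤ l) (hΛ : Λ l = 0) (x : V) (hx : Word e v x) :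
    ∃ μ : Fin N → ℂ, (∀ b, e b b x = μ b • x) ∧ ∃ k : ℕ, μ l = k := by
  induction hx with
  | base => exact ⟨Λ, h2, 0, by simpa using hΛ⟩
  | step c d x h hx ih =>
    obtain ⟨μ, h1, k, hk⟩ := ih
    refine ⟨fun b => μ b + (if b = c then 1 else 0) - (if d = b then 1 else 0), ?_,
      k + if l = c then 1 else 0, ?_⟩
    · intro b
      have := he b b c d x
      rw [sub_eq_iff_eq_add] at this
      rw [this, h1, map_smul]
      by_cases g1 : b = c
      · subst g1
        have g2 : d ≠ b := h.ne
        simp only [g2, if_true, if_false]; module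
      · by_cases g2 : d = b
        · subst g2
          simp only [g1, if_true, if_false]; module
        · simp only [g1, g2, if_false]; module
    · have : d ≠ l := fun h' => absurd (hl c) (by rw [← h']; exact not_le.mpr h)
      simp only [hk, this, if_false]
      split_ifs <;> simp

lemma sl2_pow (he : Gl e) {a l : Fin N} (hal : a ≠ l) {y : V} {lam : ℂ} {k : ℕ}
    (h1 : e a a y = lam • y) (h2 : e l l y = (k : ℂ) • y) (h3 : e l a y = 0) : ∀ j : ℕ,
    e a a (((e a l) ^ j) y) = (lam + j) • ((e a l) ^ j) y ∧
    e l l (((e a l) ^ j) y) = ((k : ℂ) - j) • ((e a l) ^ j) y ∧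
    e l a (((e a l) ^ (j + 1)) y) = ((j + 1 : ℂ) * (k - lam - j)) • ((e a l) ^ j) y := by
  have c1 : ∀ x, e l a (e a l x) = e a l (e l a x) + e l l x - e a a x := by
    intro x
    have := he l a a l x
    rw [sub_eq_iff_eq_add] at this
    rw [this]; simp; abel
  have c2 : ∀ x, e a a (e a l x) = e a l (e a a x) + e a l x := by
    intro x
    have := he a a a l x
    rw [sub_eq_iff_eq_add] at this
    rw [this]; simp [hal.symm]; abel
  have c3 : ∀ x, e l l (e a l x) = e a l (e l l x) - e a l x := by
    intro x
    have := he l l a l x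
    rw [sub_eq_iff_eq_add] at this
    rw [this]; simp [hal.symm]; abel
  intro j
  induction j with
  | zero =>
    refine ⟨by simpa using h1, by simpa using h2, ?_⟩
    simp [c1, h1, h2, h3, sub_smul]
  | succ j ih =>
    obtain ⟨i1, i2, i3⟩ := ih
    have p : ∀ i, ((e a l) ^ (i + 1)) y = e a l (((e a l) ^ i) y) := by
      intro i; rw [pow_succ', Module.End.mul_apply]
    have q1 : e a a (((e a l) ^ (j + 1)) y) = (lam + (j + 1 : ℕ)) • ((e a l) ^ (j + 1)) y := by
      rw [p, c2, i1, map_smul]; push_cast; module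
    have q2 : e l l (((e a l) ^ (j + 1)) y) = ((k : ℂ) - (j + 1 : ℕ)) • ((e a l) ^ (j + 1)) y := by
      rw [p, c3, i2, map_smul]; push_cast; module
    refine ⟨q1, q2, ?_⟩
    rw [p (j + 1), c1, i3, q1, q2, map_smul, ← p]
    push_cast
    module

lemma nat_weight [FiniteDimensional ℂ V] (he : Gl e) {a l : Fin N} {K : ℕ}
    (hK : Polynomial.aeval (e l l) (nnp K) = 0) (lam : ℂ) (h : (e a a).HasEigenvalue lam) :
    ∃ k : ℕ, lam = k := by
  -- natural eigenvectors for `e l l`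
  have key : ∀ x : V, x ≠ 0 → ∀ lam : ℂ, e a a x = lam • x → ∃ y : V, y ≠ 0 ∧ e a a y = lam • y ∧
      ∃ k : ℕ, e l l y = (k : ℂ) • y := by
    intro x hx lam hlam
    have hex : ∃ K, Polynomial.aeval (e l l) (nnp K) x = 0 := ⟨K, by rw [hK]; simp⟩
    classical
    obtain ⟨K, hK, hmin⟩ : ∃ K, Polynomial.aeval (e l l) (nnp K) x = 0 ∧
        ∀ k < K, Polynomial.aeval (e l l) (nnp k) x ≠ 0 :=
      ⟨Nat.find hex, Nat.find_spec hex, fun k hk => Nat.find_min hex hk⟩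
    cases K with
    | zero => simp [nnp] at hK; exact absurd hK hx
    | succ K =>
      refine ⟨_, hmin K (by omega), ?_, K, ?_⟩
      · have hcomm : ∀ g, e l l (e a a g) = e a a (e l l g) := by
          intro g
          have := he l l a a g
          rw [sub_eq_iff_eq_add] at this
          rw [this]
          by_cases h : l = a
          · subst h; simp
          · simp [h, Ne.symm h]
        have := aeval_intertwine (e a a) (e l l) (e l l) hcomm (nnp K) x
        rw [← this, hlam, map_smul]
      · rw [nnp_succ, mul_comm, map_mul, Module.End.mul_apply] at hK
        simp only [map_sub, Polynomial.aeval_X, Polynomial.aeval_C, LinearMap.sub_apply,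
          sub_eq_zero] at hK
        rw [hK]; rfl
  by_contra hcon
  by_cases hal : a = l
  · subst hal
    obtain ⟨x, hx⟩ := h.exists_hasEigenvector
    obtain ⟨y, hy, hy1, k, hy2⟩ := key x hx.2 lam hx.apply_eq_smul
    rw [hy1, ← sub_eq_zero, ← sub_smul, smul_eq_zero] at hy2
    rcases hy2 with h | h
    · exact hcon ⟨k, sub_eq_zero.mp h⟩
    · exact hy h
  -- minimal real part
  have hfin : {μ : ℂ | (e a a).HasEigenvalue μ ∧ ¬ ∃ k : ℕ, μ = k}.Finite :=
    (Module.End.finite_hasEigenvalue (e a a)).subset fun x hx => hx.1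
  obtain ⟨μ, ⟨hμ, hμn⟩, hmin⟩ := Set.exists_min_image _ (fun x : ℂ => x.re) hfin ⟨lam, h, hcon⟩
  obtain ⟨x, hx⟩ := hμ.exists_hasEigenvector
  obtain ⟨y, hy, hy1, k, hy2⟩ := key x hx.2 μ hx.apply_eq_smul
  have h3 : e l a y = 0 := by
    by_contra h0
    have c : e a a (e l a y) = (μ - 1) • e l a y := by
      have := he a a l a y
      rw [sub_eq_iff_eq_add] at this
      rw [this, hy1, map_smul]; simp [hal]; module
    have := hmin (μ - 1) ⟨Module.End.hasEigenvalue_of_hasEigenvector (x := e l a y)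
      ⟨Module.End.mem_eigenspace_iff.mpr c, h0⟩, fun ⟨k, hk⟩ => hμn ⟨k + 1, by
        push_cast; rw [← hk]; ring⟩⟩
    simp at this
    linarith
  have hne : ∀ j : ℕ, j ≤ k + 1 → ((e a l) ^ j) y ≠ 0 := by
    intro j
    induction j with
    | zero => intro _; simpa using hy
    | succ j ih =>
      intro hjk h0
      have := (sl2_pow he hal hy1 hy2 h3 j).2.2
      rw [h0, map_zero, eq_comm, smul_eq_zero] at this
      rcases this with h | h
      · rcases mul_eq_zero.mp h with h | h
        · exact absurd h (by exact_mod_cast Nat.succ_ne_zero j)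
        · refine hμn ⟨k - j, ?_⟩
          rw [Nat.cast_sub (by omega)]
          linear_combination -h
      · exact ih (by omega) h
  refine hne (k + 1) le_rfl (nn_neg hK ?_)
  rw [(sl2_pow he hal hy1 hy2 h3 (k + 1)).2.1]
  push_cast
  module

lemma HW_nn [FiniteDimensional ℂ V] (he : Gl e) (h1 : ∀ a b : Fin N, a < b → e a b v = 0)
    (Λ : Fin N → ℂ) (h2 : ∀ a, e a a v = Λ a • v)
    (h3 : ∀ W : Submodule ℂ V, (∀ a b : Fin N, ∀ x ∈ W, e a b x ∈ W) → v ∈ W → ∀ x, x ∈ W)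
    (l : Fin N) (hl : ∀ c, c ≤ l) (hΛ : Λ l = 0) (a : Fin N) :
    ∃ K, Polynomial.aeval (e a a) (nnp K) = 0 := by
  have hs := Word_span he h1 Λ h2 h3
  -- reduction to natural eigenvalues on words
  have red : ∀ b, (∀ x, Word e v x → x ≠ 0 → ∃ k : ℕ, e b b x = (k : ℂ) • x) →
      ∃ K, Polynomial.aeval (e b b) (nnp K) = 0 := by
    intro b hb
    have hfin : {k : ℕ | (e b b).HasEigenvalue (k : ℂ)}.Finite :=
      (Module.End.finite_hasEigenvalue (e b b)).preimage (Nat.cast_injective.injOn)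
    obtain ⟨B, hB⟩ := hfin.bddAbove
    refine ⟨B + 1, ?_⟩
    refine LinearMap.ext_on hs ?_
    intro x hx
    by_cases hx0 : x = 0
    · rw [hx0]; simp
    obtain ⟨k, hk⟩ := hb x hx hx0
    have hev : (e b b).HasEigenvector (k : ℂ) x := ⟨Module.End.mem_eigenspace_iff.mpr hk, hx0⟩
    have hkB : k ≤ B := hB (Module.End.hasEigenvalue_of_hasEigenvector hev)
    rw [Module.End.aeval_apply_of_hasEigenvector hev]
    have : Polynomial.eval (k : ℂ) (nnp (B + 1)) = 0 := by
      unfold nnp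
      rw [Polynomial.eval_prod]
      exact Finset.prod_eq_zero (i := k) (by simp; omega) (by simp)
    rw [this]; simp
  obtain ⟨K, hK⟩ := red l (fun x hx _ => by
    obtain ⟨μ, hμ, k, hk⟩ := Word_weight he Λ h2 l hl hΛ x hx
    exact ⟨k, by rw [hμ, hk]⟩)
  refine red a (fun x hx hx0 => ?_)
  obtain ⟨μ, hμ, -⟩ := Word_weight he Λ h2 l hl hΛ x hx
  obtain ⟨k, hk⟩ := nat_weight he hK (μ a) (Module.End.hasEigenvalue_of_hasEigenvector (x := x)
    ⟨Module.End.mem_eigenspace_iff.mpr (hμ a), hx0⟩)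
  exact ⟨k, by rw [hμ, hk]⟩

end HW

section Hat
variable {N n : ℕ} (V : Fin n → Type*) [∀ i, AddCommGroup (V i)] [∀ i, Module ℂ (V i)]
  (M : Type*) [AddCommGroup M] [Module ℂ M]
  (φ : M ≃ₗ[ℂ] PiTensorProduct ℂ V)

/-- Endomorphism of one factor, acting on the tensor product. -/
def hat0 (j : Fin n) (f : Module.End ℂ (V j)) : Module.End ℂ M :=
  φ.symm.toLinearMap ∘ₗ
    (PiTensorProduct.map
      (Function.update (fun i : Fin n => (LinearMap.id : V i →ₗ[ℂ] V i)) j f)) ∘ₗ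
    φ.toLinearMap

lemma hat0_add (j : Fin n) (f g : Module.End ℂ (V j)) :
    hat0 V M φ j (f + g) = hat0 V M φ j f + hat0 V M φ j g := by
  unfold hat0
  rw [PiTensorProduct.map_update_add]
  ext x; simp

lemma hat0_smul (j : Fin n) (c : ℂ) (f : Module.End ℂ (V j)) :
    hat0 V M φ j (c • f) = c • hat0 V M φ j f := by
  unfold hat0
  rw [PiTensorProduct.map_update_smul]
  ext x; simp

lemma hat0_mul' (i j : Fin n) (f : Module.End ℂ (V i)) (g : Module.End ℂ (V j)) :
    hat0 V M φ i f * hat0 V M φ j g = φ.symm.toLinearMap ∘ₗ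
    (PiTensorProduct.map fun k =>
      (Function.update (fun i : Fin n => (LinearMap.id : V i →ₗ[ℂ] V i)) i f k) ∘ₗ
      (Function.update (fun i : Fin n => (LinearMap.id : V i →ₗ[ℂ] V i)) j g k)) ∘ₗ
    φ.toLinearMap := by
  rw [PiTensorProduct.map_comp]
  ext x; simp [hat0]

lemma hat0_mul (j : Fin n) (f g : Module.End ℂ (V j)) :
    hat0 V M φ j (f * g) = hat0 V M φ j f * hat0 V M φ j g := by
  rw [hat0_mul']
  unfold hat0
  congr 3
  funext k
  by_cases h : k = j
  · subst h; simp; rfl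
  · simp [h]

lemma hat0_one (j : Fin n) : hat0 V M φ j 1 = 1 := by
  unfold hat0
  have : Function.update (fun i : Fin n => (LinearMap.id : V i →ₗ[ℂ] V i)) j
    (1 : Module.End ℂ (V j)) = fun i => LinearMap.id := by
    funext k
    by_cases h : k = j
    · subst h; simp; rfl
    · simp [h]
  rw [this, PiTensorProduct.map_id]
  ext x; simp

lemma hat0_comm (i j : Fin n) (h : i ≠ j) (f : Module.End ℂ (V i)) (g : Module.End ℂ (V j)) :
    hat0 V M φ i f * hat0 V M φ j g = hat0 V M φ j g * hat0 V M φ i f := by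
  rw [hat0_mul', hat0_mul']
  congr 3
  funext k
  by_cases h1 : k = i
  · subst h1; simp [h]
  · by_cases h2 : k = j
    · subst h2; simp [h1]
    · simp [h1, h2]

/-- `hat0` as an algebra homomorphism. -/
def hat (j : Fin n) : Module.End ℂ (V j) →ₐ[ℂ] Module.End ℂ M :=
  AlgHom.ofLinearMap (LinearMap.mk ⟨hat0 V M φ j, hat0_add V M φ j⟩ (hat0_smul V M φ j))
    (hat0_one V M φ j) (hat0_mul V M φ j)

variable (E : ∀ i : Fin n, Fin N → Fin N → (V i →ₗ[ℂ] V i))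

lemma EE_hat (j : Fin n) (a b : Fin N) : EE V M E φ j a b = hat V M φ j (E j a b) := rfl

lemma Chain_EE [∀ i, FiniteDimensional ℂ (V i)] (hN : 0 < N) (Λ : Fin n → Fin N → ℤ)
    (hlast : ∀ i, Λ i ⟨N - 1, by omega⟩ = 0) (hrel : GlRel V E) (hhw : IsHW V E Λ) :
    Chain (EE V M E φ) := by
  have hgl : ∀ j, Gl (fun a b => (E j a b : Module.End ℂ (V j))) := by
    intro j a b c d v
    have := congrArg (fun f : Module.End ℂ (V j) => f v) (hrel j a b c d)
    simp only [LinearMap.sub_apply, LinearMap.comp_apply, LinearMap.smul_apply] at this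
    rw [this]
    split_ifs <;> simp
  refine ⟨?_, ?_, ?_⟩
  · intro j a b c d v
    have h : (E j a b : Module.End ℂ (V j)) * E j c d - E j c d * E j a b =
      (if b = c then (1 : ℂ) else 0) • E j a d - (if d = a then (1 : ℂ) else 0) • E j c b :=
        hrel j a b c d
    have := congrArg (fun f : Module.End ℂ (V j) => hat V M φ j f v) h
    simp only [map_sub, map_mul, map_smul, LinearMap.sub_apply, Module.End.mul_apply,
      LinearMap.smul_apply, ← EE_hat] at this
    rw [this]
    split_ifs <;> simp
  · intro i j hij a b c d v
    have := hat0_comm V M φ i j hij (E i a b) (E j c d)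
    exact congrArg (fun f : Module.End ℂ M => f v) this
  · intro j a
    obtain ⟨v, -, h1, h2, h3⟩ := hhw j
    obtain ⟨K, hK⟩ := HW_nn (e := fun a b => (E j a b : Module.End ℂ (V j))) (hgl j) h1
      (fun a => (Λ j a : ℂ)) h2 h3 ⟨N - 1, by omega⟩
      (fun c => by rw [Fin.le_def]; simp; omega) (by simp [hlast]) a
    refine ⟨K, ?_⟩
    rw [EE_hat, Polynomial.aeval_algHom_apply, hK, map_zero]

end Hat
end XXXModel

namespace XXXModel

section Ind
variable {M : Type*} [AddCommGroup M] [Module ℂ M]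

/-- Shift of sequences. -/
def shf (M : Type*) [AddCommGroup M] [Module ℂ M] : Module.End ℂ (ℕ → M) :=
  LinearMap.funLeft ℂ M (fun k => k + 1)

lemma shf_apply (g : ℕ → M) (k : ℕ) : shf M g k = g (k + 1) := rfl

lemma shf_pow (Q x : ℂ) (w : M) (n : ℕ) : ∀ f : ℂ → ℂ,
    ((shf M - Q • (1 : Module.End ℂ (ℕ → M))) ^ n) (fun k : ℕ => (Q ^ k * f (x + k)) • w) =
      fun k : ℕ => (Q ^ (k + n) * ((fwdDiff (1 : ℂ))^[n] f) (x + k)) • w := by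
  induction n with
  | zero => intro f; simp
  | succ n ih =>
    intro f
    rw [pow_succ, Module.End.mul_apply]
    have : (shf M - Q • (1 : Module.End ℂ (ℕ → M))) (fun k : ℕ => (Q ^ k * f (x + k)) • w) =
        Q • (fun k : ℕ => (Q ^ k * (fwdDiff (1 : ℂ) f) (x + k)) • w) := by
      funext k
      simp only [LinearMap.sub_apply, Pi.sub_apply, shf_apply, LinearMap.smul_apply,
        Module.End.one_apply, Pi.smul_apply, fwdDiff]
      push_cast
      rw [← add_assoc, pow_succ]
      module
    rw [this, map_smul, ih]
    funext k
    simp only [Pi.smul_apply, Function.iterate_succ_apply, smul_smul]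
    congr 1
    ring

lemma mem_gen (Q x : ℂ) (w : M) (j : ℕ) :
    (fun k : ℕ => (Q ^ k * (x + k) ^ j) • w) ∈ (shf M).maxGenEigenspace Q := by
  rw [Module.End.mem_maxGenEigenspace]
  refine ⟨j + 1, ?_⟩
  rw [shf_pow Q x w (j + 1) (fun r => r ^ j), fwdDiff_iter_pow_eq_zero_of_lt (by omega)]
  funext k; simp

lemma coef_zero (x : ℂ) (n : ℕ) (w : ℕ → M)
    (h : ∀ k : ℕ, ∑ t ∈ Finset.range n, (x + k) ^ t • w t = 0) : ∀ t < n, w t = 0 := by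
  intro t ht
  rw [← Module.forall_dual_apply_eq_zero_iff ℂ]
  intro f
  set p : Polynomial ℂ := ∑ t ∈ Finset.range n, Polynomial.monomial t (f (w t)) with hp
  have hp0 : p = 0 := by
    refine Polynomial.eq_zero_of_infinite_isRoot p ?_
    refine Set.Infinite.mono ?_ (Set.infinite_range_of_injective
      (f := fun k : ℕ => x + k) (fun a b hab => by simpa using hab))
    rintro _ ⟨k, rfl⟩
    have := congrArg f (h k)
    simp only [map_sum, map_smul, map_zero, smul_eq_mul] at this
    simp only [Set.mem_ofPred_eq, Polynomial.IsRoot, hp, Polynomial.eval_finsetSum,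
      Polynomial.eval_monomial]
    rw [← this]
    exact Finset.sum_congr rfl fun _ _ => mul_comm _ _
  have := congrArg (fun p => Polynomial.coeff p t) hp0
  simpa [hp, Polynomial.finsetSum_coeff, Polynomial.coeff_monomial, ht] using this

lemma coef_zero' (x : ℂ) (n : ℕ) (w : ℕ → M)
    (h : ∀ k : ℕ, ∑ t ∈ Finset.range (n + 1), (x + k) ^ (n - t) • w t = 0) :
    ∀ t < n + 1, w t = 0 := by
  intro t ht
  have := coef_zero x (n + 1) (fun t => w (n - t)) (fun k => by
    rw [← h k, ← Finset.sum_range_reflect]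
    refine Finset.sum_congr rfl fun t ht => ?_
    rw [Finset.mem_range] at ht
    congr 2 <;> congr 1 <;> omega) (n - t) (by omega)
  rwa [Nat.sub_sub_self (by omega)] at this

lemma MeromAt_iff (g : ℂ → ℂ) (x : ℂ) : MeromAt g x ↔ MeromorphicAt g x := Iff.rfl

lemma per_nat {c : ℂ → ℂ} (hc : ∀ x, c (x + 1) = c x) (k : ℕ) (x : ℂ) : c (x + k) = c x := by
  induction k with
  | zero => simp
  | succ k ih => push_cast; rw [← add_assoc, hc, ih]

lemma per_analytic {c : ℂ → ℂ} (hc : ∀ x, c (x + 1) = c x) (k : ℕ) (x : ℂ)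
    (h : AnalyticAt ℂ c x) : AnalyticAt ℂ c (x + k) := by
  have e : c = c ∘ fun y => y - k := by
    funext y
    simp only [Function.comp]
    rw [← per_nat hc k (y - k), sub_add_cancel]
  rw [e]
  refine AnalyticAt.comp (by simpa using h) (by fun_prop)

lemma indep_all {N d : ℕ} {ι : Type*} [Fintype ι] (eι : ι ≃ Fin N × Fin d)
    (q Q : Fin N → ℂ) (hq : ∀ i, Complex.exp (q i) = Q i)
    (hQ : ∀ i j, i ≠ j → Q i ≠ Q j) (m : Fin N → ℕ) (v : Fin N → Fin d → ℕ → M)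
    (b : Fin d → M) (hb : LinearIndependent ℂ b) (hv : ∀ i s, v i s 0 = b s)
    (F : ι → ℂ → M) (hF : ∀ t x, F t x = Complex.exp (q (eι t).1 * x) •
      ∑ s ∈ Finset.range (m (eι t).1 + 1), (x ^ (m (eι t).1 - s)) • v (eι t).1 (eι t).2 s) :
    IndepPeriodic F := by
  intro c hm hper hsum
  have pt : ∀ x, (∀ i, AnalyticAt ℂ (c i) x) → ∀ i, c i x = 0 := by
    intro x hx
    -- the pieces
    set w : Fin N → ℕ → M := fun i t => ∑ s, (c (eι.symm (i, s)) x * Complex.exp (q i * x)) • v i s t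
      with hw
    set g : Fin N → ℕ → M := fun i => ∑ t ∈ Finset.range (m i + 1),
      (fun k : ℕ => (Q i ^ k * (x + k) ^ (m i - t)) • w i t) with hg
    have hexp : ∀ i (k : ℕ), Complex.exp (q i * (x + k)) = Complex.exp (q i * x) * Q i ^ k := by
      intro i k
      rw [mul_add, Complex.exp_add, mul_comm (q i) (k : ℂ), Complex.exp_nat_mul, hq]
    have hg0 : ∑ i, g i = 0 := by
      funext k
      have h := hsum (x + k) (fun i => per_analytic (hper i) k x (hx i))
      simp only [per_nat (hper _)] at h
      rw [← Equiv.sum_comp eι.symm, Fintype.sum_prod_type] at h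
      rw [Finset.sum_apply, Pi.zero_apply, ← h]
      refine Finset.sum_congr rfl fun i _ => ?_
      simp only [hF, Equiv.apply_symm_apply, hexp, hg, Finset.sum_apply, hw, Finset.smul_sum]
      rw [Finset.sum_comm]
      refine Finset.sum_congr rfl fun s _ => Finset.sum_congr rfl fun t _ => ?_
      simp only [smul_smul]
      congr 1
      ring
    have hmem : ∀ i, g i ∈ (shf M).maxGenEigenspace (Q i) := fun i =>
      Submodule.sum_mem _ fun t _ => mem_gen (Q i) x (w i t) _
    have hind := (Module.End.independent_maxGenEigenspace (shf M)).comp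
      (f := Q) (fun i j h => by_contra fun hne => hQ i j hne h)
    have hgi : ∀ i, g i = 0 := by
      rw [iSupIndep_iff_finsetSum_eq_zero_imp_eq_zero] at hind
      intro i
      exact hind Finset.univ g (fun i _ => hmem i) hg0 i (Finset.mem_univ _)
    have hQ0 : ∀ i, Q i ≠ 0 := fun i => by rw [← hq]; exact Complex.exp_ne_zero _
    have hw0 : ∀ i, w i 0 = 0 := by
      intro i
      refine coef_zero' x (m i) (w i) (fun k => ?_) 0 (by omega)
      have := congrFun (hgi i) k
      simp only [hg, Finset.sum_apply, mul_smul, ← Finset.smul_sum, Pi.zero_apply] at this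
      exact (smul_eq_zero.mp this).resolve_left (pow_ne_zero _ (hQ0 i))
    intro t
    have h0 := hw0 (eι t).1
    simp only [hw, hv] at h0
    have := Fintype.linearIndependent_iff.mp hb _ h0 (eι t).2
    simpa [Complex.exp_ne_zero] using this
  intro i x hix
  have h1 : ∀ᶠ y in nhdsWithin x {x}ᶜ, ∀ i, AnalyticAt ℂ (c i) y :=
    Filter.eventually_all.mpr fun j => MeromorphicAt.eventually_analyticAt (hm j x)
  have h2 : ∀ᶠ y in nhdsWithin x {x}ᶜ, c i y = 0 := h1.mono fun y hy => pt y hy i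
  have h3 : Filter.Tendsto (c i) (nhdsWithin x {x}ᶜ) (nhds (c i x)) :=
    hix.continuousAt.tendsto.mono_left nhdsWithin_le_nhds
  have h4 : Filter.Tendsto (c i) (nhdsWithin x {x}ᶜ) (nhds 0) :=
    tendsto_const_nhds.congr' (h2.mono fun y hy => hy.symm)
  exact tendsto_nhds_unique h3 h4

end Ind
end XXXModel

namespace XXXModel

lemma Sol_coeff {N n : ℕ} {M : Type*} [AddCommGroup M] [Module ℂ M] {a : Fin N} {ρ : Fin N → ℂ}
    {z : Fin n → ℂ} {e : Fin n → Fin N → Fin N → Module.End ℂ M} {m : Fin N → ℕ} {v0 : M}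
    (h : Sol a ρ z e m v0) (hv0 : ∀ b, (∑ j, e j b b) v0 = (m b : ℂ) • v0) :
    ∃ v : ℕ → M, (∀ t b, (∑ j, e j b b) (v t) = (m b : ℂ) • v t) ∧ v 0 = v0 ∧
      ∃ ψ : (Fin N → ℕ) → ℂ → M, Sys a ρ (fun u => ∀ j, u ≠ z j) (TC z e) ψ ∧
        ∀ x, ψ 0 x = ∑ t ∈ Finset.range (m a + 1), (x ^ (m a - t)) • v t := by
  obtain ⟨ψ, h1, -, ⟨w, hw⟩, h4⟩ := h
  set v : ℕ → M := fun t => if t = 0 then v0 else if t ≤ m a then w (m a - t) else 0 with hv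
  have hψ : ∀ x, ψ 0 x = ∑ t ∈ Finset.range (m a + 1), (x ^ (m a - t)) • v t := by
    intro x
    have h := hw x
    simp only [sub_eq_iff_eq_add] at h
    rw [h, Finset.sum_range_succ', ← Finset.sum_range_reflect]
    congr 1
    refine Finset.sum_congr rfl fun t ht => ?_
    rw [Finset.mem_range] at ht
    have e1 : m a - 1 - t = m a - (t + 1) := by omega
    simp only [hv, e1, Nat.add_eq_zero_iff, one_ne_zero, and_false, if_false,
      if_pos (show t + 1 ≤ m a by omega)]
  refine ⟨v, ?_, by simp [hv], ψ, h1, hψ⟩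
  intro t b
  by_cases ht : t < m a + 1
  · have := coef_zero' 0 (m a) (fun t => (∑ j, e j b b) (v t) - (m b : ℂ) • v t) (fun k => ?_) t ht
    · exact sub_eq_zero.mp this
    · have h := h4 0 b (0 + k)
      rw [hψ] at h
      simp only [Pi.zero_apply, Finset.sum_const_zero, Nat.cast_zero, add_zero, ite_self,
        sub_zero] at h
      rw [map_sum, Finset.smul_sum] at h
      simp only [smul_sub, Finset.sum_sub_distrib]
      rw [sub_eq_zero]
      simp only [map_smul] at h
      rw [h]
      exact Finset.sum_congr rfl fun t _ => smul_comm _ _ _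
  · have : v t = 0 := by
      simp only [hv]
      rw [if_neg (by omega), if_neg (by omega)]
    rw [this]; simp

lemma mem_Wt {N n : ℕ} (V : Fin n → Type*) [∀ i, AddCommGroup (V i)] [∀ i, Module ℂ (V i)]
    (M : Type*) [AddCommGroup M] [Module ℂ M] (E : ∀ i : Fin n, Fin N → Fin N → (V i →ₗ[ℂ] V i))
    (φ : M ≃ₗ[ℂ] PiTensorProduct ℂ V) (m : Fin N → ℕ) (v : M) :
    v ∈ Wt V M E φ (fun b => (m b : ℤ)) ↔
      ∀ b, (∑ j, EE V M E φ j b b) v = (m b : ℂ) • v := by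
  unfold Wt
  simp only [Submodule.mem_iInf, LinearMap.mem_ker, LinearMap.sub_apply, LinearMap.smul_apply,
    Module.End.one_apply, sub_eq_zero, Int.cast_natCast]

theorem statement_8
    {N n : ℕ} (hN : 2 ≤ N) (hn : 1 ≤ n)
    (V : Fin n → Type*) [∀ i, AddCommGroup (V i)] [∀ i, Module ℂ (V i)]
    [∀ i, FiniteDimensional ℂ (V i)]
    (M : Type*) [AddCommGroup M] [Module ℂ M] [FiniteDimensional ℂ M]
    (Λ : Fin n → Fin N → ℤ)
    (hdom : ∀ i, ∀ a b : Fin N, a ≤ b → Λ i b ≤ Λ i a)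
    (hpoly : ∀ i a, 0 ≤ Λ i a)
    (hlast : ∀ i, Λ i ⟨N - 1, by omega⟩ = 0)
    (E : ∀ i : Fin n, Fin N → Fin N → (V i →ₗ[ℂ] V i))
    (hrel : GlRel V E)
    (hhw : IsHW V E Λ)
    (φ : M ≃ₗ[ℂ] PiTensorProduct ℂ V)
    (z : Fin n → ℂ)
    (Q : Fin N → ℂ) (q : Fin N → ℂ) (hq : ∀ i, Complex.exp (q i) = Q i)
    (hQne : ∀ i, Q i ≠ 0) (hQdist : ∀ i j, i ≠ j → Q i ≠ Q j)
    (m : Fin N → ℕ) :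
    -- for every `i` and every nonzero `v₀ ∈ M[m]` there is a quasi-exponential
    -- `Q_i^u (v₀ u^{m_i} + … + v_{m_i})` in the kernel
    (∀ i : Fin N, ∀ v0 ∈ Wt V M E φ (fun b => (m b : ℤ)), v0 ≠ 0 →
      ∃ v : ℕ → M, (∀ t, v t ∈ Wt V M E φ (fun b => (m b : ℤ))) ∧ v 0 = v0 ∧
        ∀ u : ℂ, Good N z u →
          Dop V M E φ z (Matrix.diagonal Q)
            (fun x => Complex.exp (q i * x) •
              ∑ t ∈ Finset.range (m i + 1), (x ^ (m i - t)) • v t) u = 0) ∧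
    -- such quasi-exponentials generate the kernel
    ∃ F : Fin (N * Module.finrank ℂ (Wt V M E φ (fun b => (m b : ℤ)))) → ℂ → M,
      (∀ t, ∃ (i : Fin N) (v : ℕ → M),
        (∀ s, v s ∈ Wt V M E φ (fun b => (m b : ℤ))) ∧ v 0 ≠ 0 ∧
        F t = fun x => Complex.exp (q i * x) •
          ∑ s ∈ Finset.range (m i + 1), (x ^ (m i - s)) • v s) ∧
      (∀ t, ∀ u : ℂ, Good N z u →
        Dop V M E φ z (Matrix.diagonal Q) (F t) u = 0) ∧
      IndepPeriodic F := by
  have hC : Chain (EE V M E φ) := Chain_EE V M φ E (by omega) Λ hlast hrel hhw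
  have main : ∀ i : Fin N, ∀ v0 ∈ Wt V M E φ (fun b => (m b : ℤ)),
      ∃ v : ℕ → M, (∀ t, v t ∈ Wt V M E φ (fun b => (m b : ℤ))) ∧ v 0 = v0 ∧
        ∀ u : ℂ, Good N z u →
          Dop V M E φ z (Matrix.diagonal Q)
            (fun x => Complex.exp (q i * x) •
              ∑ t ∈ Finset.range (m i + 1), (x ^ (m i - t)) • v t) u = 0 := by
    intro i v0 hv0
    rw [mem_Wt] at hv0
    have hS := Sol_weight (a := i) (ρ := fun c => Q c / Q i) (div_self (hQne i))
      (fun k hk h => hQdist k i hk ((div_eq_one_iff_eq (hQne i)).mp h)) M z (EE V M E φ) hC m v0 hv0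
    obtain ⟨v, hv, hv1, ψ, hψ, hψ0⟩ := Sol_coeff hS hv0
    refine ⟨v, fun t => (mem_Wt V M E φ m _).mpr (hv t), hv1, fun u hu => ?_⟩
    have := Dop_Sol V M E φ z Q (by omega) hC u hu i (q i) (hq i) ψ hψ
    simp only [hψ0] at this
    exact this
  refine ⟨fun i v0 hv0 _ => main i v0 hv0, ?_⟩
  set W := Wt V M E φ (fun b => (m b : ℤ)) with hW
  let b := Module.finBasis ℂ W
  choose v hv1 hv2 hv3 using fun (i : Fin N) (s : Fin (Module.finrank ℂ W)) =>
    main i (b s : M) (b s).2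
  have hbne : ∀ s, (b s : M) ≠ 0 := fun s h => b.ne_zero s (by simpa using h)
  refine ⟨fun t x => Complex.exp (q (finProdFinEquiv.symm t).1 * x) •
    ∑ s ∈ Finset.range (m (finProdFinEquiv.symm t).1 + 1),
      (x ^ (m (finProdFinEquiv.symm t).1 - s)) •
        v (finProdFinEquiv.symm t).1 (finProdFinEquiv.symm t).2 s, ?_, ?_, ?_⟩
  · intro t
    exact ⟨(finProdFinEquiv.symm t).1, v (finProdFinEquiv.symm t).1 (finProdFinEquiv.symm t).2,
      hv1 _ _, by rw [hv2]; exact hbne _, rfl⟩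
  · intro t u hu
    exact hv3 _ _ u hu
  · exact indep_all finProdFinEquiv.symm q Q hq hQdist m v (fun s => (b s : M))
      (b.linearIndependent.map' W.subtype W.ker_subtype) hv2 _ (fun t x => rfl)

end XXXModel
end
end
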